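/- arXiv:2408.15648 — 5 statements merged into one kernel-verified Lean document; each statement's English description precedes it below -/
import Mathlib

section
/- Fix an integer d ≥ 2. There is a constant C > 0 depending only on d such that for all real x ≥ 2, |#ℛ^(d)(x) − (2x)^{2d+2}/(2ζ(2d+2))| ≤ C·x^{2d+1}·log x, where ζ is the Riemann zeta function. Consequently, #ℛ^(d)(x)/#𝒫(x) → 1 as x → ∞. -/
open Filter MvPolynomial

noncomputable section

/-- The `2d × 2d` Sylvester matrix of the two generic binary forms of degree `d`,
with entries taken from the coordinates of `Q` (the first `d+1` coordinates of `Q`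
are the coefficients of `F`, the last `d+1` ones those of `G`). -/
def sylvesterMat (d : ℕ) {R : Type*} [CommRing R] (Q : Fin (2 * d + 2) → R) :
    Matrix (Fin (2 * d)) (Fin (2 * d)) R :=
  Matrix.of fun i j =>
    if hi : (i : ℕ) < d then
      if h : (i : ℕ) ≤ (j : ℕ) ∧ (j : ℕ) ≤ (i : ℕ) + d then
        Q ⟨(j : ℕ) - (i : ℕ), by omega⟩
      else 0
    else
      if h : (i : ℕ) - d ≤ (j : ℕ) ∧ (j : ℕ) ≤ (i : ℕ) then
        Q ⟨d + 1 + ((j : ℕ) - ((i : ℕ) - d)), by omega⟩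
      else 0

/-- The generic resultant polynomial `𝔯 ∈ ℤ[x₀,…,x_d,y₀,…,y_d]`:
the determinant of the Sylvester matrix of the generic binary forms of degree `d`. -/
def resPoly (d : ℕ) : MvPolynomial (Fin (2 * d + 2)) ℤ :=
  Matrix.det (sylvesterMat d fun i => X i)

/-- Evaluation `𝔯(Q)` of the generic resultant at a tuple `Q` with entries in a
commutative ring (i.e. evaluation of the image of `𝔯` under the coefficient map `ℤ → R`). -/
def resEval (d : ℕ) {R : Type*} [CommRing R] (Q : Fin (2 * d + 2) → R) : R :=
  aeval Q (resPoly d)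

/-- The set `𝒫 ⊆ ℤ^{2d+2}` identified with `ℙ^{2d+1}(ℚ)`: integer tuples with gcd `1`
whose first nonzero coordinate is positive. -/
def projPts (d : ℕ) : Set (Fin (2 * d + 2) → ℤ) :=
  {C | Finset.univ.gcd C = 1 ∧ ∃ i, 0 < C i ∧ ∀ j, j < i → C j = 0}

/-- The box of integer tuples with `|xᵢ| ≤ rᵢ` for all `i`. -/
def box {m : ℕ} (r : Fin m → ℝ) : Set (Fin m → ℤ) :=
  {x | ∀ i, |(x i : ℝ)| ≤ r i}

/-- The value `ζ(k)` of the Riemann zeta function at an integer `k` (for `k ≥ 2`). -/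
def zetaVal (k : ℕ) : ℝ := ∑' n : ℕ+, (1 : ℝ) / ((n : ℕ) : ℝ) ^ k

/-- The local factor `π_p^{(k)}`. -/
def piLocal (d p k : ℕ) : ℝ :=
  (Nat.card {Q : Fin (2 * d + 2) → ZMod (p ^ k) // resEval d Q ≠ 0} : ℝ) /
    ((p : ℝ) ^ ((2 * d + 2) * k) * (1 - 1 / (p : ℝ) ^ (2 * d + 2)))

open ArithmeticFunction in
lemma sum_moebius_range_of_dvd {m N : ℕ} {v : Fin m → ℤ} (hv : v ≠ 0)
    (hN : ∀ i, |v i| ≤ N) :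
    ∑ k ∈ (Finset.range (N + 1)).filter (fun k : ℕ => ∀ i, (k : ℤ) ∣ v i), moebius k =
      if Finset.univ.gcd v = 1 then 1 else 0 := by
  set g := (Finset.univ.gcd v).natAbs with hg
  have hdvd (k : ℕ) : k ∣ g ↔ ∀ i, (k : ℤ) ∣ v i := by
    rw [hg, ← Int.natCast_dvd, Finset.dvd_gcd_iff]
    simp
  obtain ⟨i, hi⟩ := Function.ne_iff.mp hv
  have hg0 : g ≠ 0 := by
    intro h
    exact hi (by simpa using (hdvd 0).1 (by simp [h]) i)
  have hset : (Finset.range (N + 1)).filter (fun k : ℕ => ∀ i, (k : ℤ) ∣ v i) = g.divisors := by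
    ext k
    simp only [Finset.mem_filter, Finset.mem_range, Nat.mem_divisors, hdvd]
    refine ⟨fun h => ⟨h.2, hg0⟩, fun h => ⟨?_, h.1⟩⟩
    have := Int.le_of_dvd (abs_pos.mpr hi) ((dvd_abs _ _).mpr (h.1 i))
    have := hN i
    omega
  have hone : g = 1 ↔ Finset.univ.gcd v = 1 := by
    rw [hg, Int.natAbs_eq_iff]
    constructor
    · rintro (h | h)
      · simpa using h
      · have h0 := Finset.normalize_gcd (s := Finset.univ) (f := v)
        rw [h] at h0
        exact absurd h0 (by decide)
    · intro h
      simp [h]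
  rw [hset, ← coe_mul_zeta_apply, moebius_mul_coe_zeta, one_apply]
  simp [hone]

lemma card_box_filter_dvd (m N k : ℕ) (hk : k ≠ 0) :
    ((Fintype.piFinset fun _ : Fin m => Finset.Icc (-(N : ℤ)) N).filter
      (fun v => v ≠ 0 ∧ ∀ i, (k : ℤ) ∣ v i)).card = (2 * (N / k) + 1) ^ m - 1 := by
  have hIcc : (Finset.Icc (-(N : ℤ)) N).filter (fun a => (k : ℤ) ∣ a) =
      (Finset.Icc (-((N / k : ℕ) : ℤ)) ((N / k : ℕ) : ℤ)).image (fun a => (k : ℤ) * a) := by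
    have hk' : (0 : ℤ) < k := by positivity
    ext a
    simp only [Finset.mem_filter, Finset.mem_Icc, Finset.mem_image, Int.natCast_ediv]
    have key (b : ℤ) : b ≤ (N : ℤ) / k ↔ k * b ≤ N := by
      rw [Int.le_ediv_iff_mul_le hk', mul_comm]
    constructor
    · rintro ⟨⟨h1, h2⟩, b, rfl⟩
      exact ⟨b, ⟨by have := (key (-b)).2 (by linarith); linarith, (key b).2 h2⟩, rfl⟩
    · rintro ⟨b, ⟨h1, h2⟩, rfl⟩
      exact ⟨⟨by have := (key (-b)).1 (by linarith); linarith, (key b).1 h2⟩, dvd_mul_right _ _⟩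
  have hset : (Fintype.piFinset fun _ : Fin m => Finset.Icc (-(N : ℤ)) N).filter
      (fun v => v ≠ 0 ∧ ∀ i, (k : ℤ) ∣ v i) =
      (Fintype.piFinset fun _ : Fin m =>
        (Finset.Icc (-(N : ℤ)) N).filter (fun a => (k : ℤ) ∣ a)).erase 0 := by
    ext v
    simp only [Finset.mem_filter, Fintype.mem_piFinset, Finset.mem_erase]
    grind
  rw [hset, Finset.card_erase_of_mem (by simp [Fintype.mem_piFinset]), Fintype.card_piFinset_const,
    hIcc, Finset.card_image_of_injective _ (mul_right_injective₀ (by exact_mod_cast hk)),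
    Int.card_Icc]
  congr 2
  omega

open ArithmeticFunction in
lemma card_box_primitive (m N : ℕ) :
    (((Fintype.piFinset fun _ : Fin m => Finset.Icc (-(N : ℤ)) N).filter
      (fun v => v ≠ 0 ∧ Finset.univ.gcd v = 1)).card : ℤ) =
      ∑ k ∈ Finset.range (N + 1), moebius k * ((2 * ((N / k : ℕ) : ℤ) + 1) ^ m - 1) := by
  have hk (k : ℕ) : moebius k * ((2 * ((N / k : ℕ) : ℤ) + 1) ^ m - 1) =
      ∑ v ∈ (Fintype.piFinset fun _ : Fin m => Finset.Icc (-(N : ℤ)) N).filter (fun v => v ≠ 0),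
        if ∀ i, (k : ℤ) ∣ v i then moebius k else 0 := by
    rcases eq_or_ne k 0 with rfl | hk
    · simp
    rw [← Finset.sum_filter, Finset.filter_filter, Finset.sum_const, card_box_filter_dvd m N k hk,
      nsmul_eq_mul, mul_comm, Nat.cast_sub (Nat.one_le_pow _ _ (by omega))]
    push_cast
    rfl
  simp_rw [hk]
  rw [Finset.sum_comm, Finset.card_filter, Nat.cast_sum, Finset.sum_filter]
  refine Finset.sum_congr rfl fun v hv => ?_
  by_cases h0 : v = 0
  · simp [h0]
  have hN : ∀ i, |v i| ≤ N := by
    simpa [Fintype.mem_piFinset, abs_le] using hv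
  rw [← Finset.sum_filter, sum_moebius_range_of_dvd h0 hN]
  simp [h0]

lemma abs_floor_pow_sub_le (m : ℕ) {y : ℝ} (hy : 0 ≤ y) :
    |((2 * (⌊y⌋₊ : ℝ) + 1) ^ (m + 1) - 1) - (2 * y) ^ (m + 1)| ≤
      ((m + 1) * 3 ^ m + 1 + 2 ^ (m + 1)) * y ^ m := by
  rcases lt_or_ge y 1 with h | h
  · rw [Nat.floor_eq_zero.2 h]
    have : y ^ (m + 1) ≤ y ^ m := pow_le_pow_of_le_one hy h.le (by omega)
    have h0 : (0 : ℝ) ≤ ((m + 1) * 3 ^ m + 1) * y ^ m := by positivity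
    have h1 : (0 : ℝ) ≤ (2 * y) ^ (m + 1) := by positivity
    simp only [Nat.cast_zero, mul_zero, zero_add, one_pow, sub_self, zero_sub, abs_neg,
      abs_of_nonneg h1]
    rw [mul_pow]
    have : (2 : ℝ) ^ (m + 1) * y ^ (m + 1) ≤ 2 ^ (m + 1) * y ^ m := by gcongr
    linarith
  · have h1 := Nat.floor_le hy
    have h2 := Nat.lt_floor_add_one y
    have h3 : (1 : ℝ) ≤ y ^ m := one_le_pow₀ h
    have hu : |2 * (⌊y⌋₊ : ℝ) + 1| ≤ 3 * y := by rw [abs_of_nonneg (by positivity)]; linarith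
    have hw : |2 * y| ≤ 3 * y := by rw [abs_of_nonneg (by positivity)]; linarith
    have key : |(2 * (⌊y⌋₊ : ℝ) + 1) ^ (m + 1) - (2 * y) ^ (m + 1)| ≤ (m + 1) * 3 ^ m * y ^ m := by
      refine (abs_pow_sub_pow_le _ _ _).trans ?_
      calc _ ≤ 1 * ((m + 1 : ℕ) : ℝ) * (3 * y) ^ m := by
            have h4 : |2 * (⌊y⌋₊ : ℝ) + 1 - 2 * y| ≤ 1 := by rw [abs_le]; constructor <;> linarith
            have h5 := max_le hu hw
            rw [Nat.add_sub_cancel]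
            gcongr
        _ = _ := by push_cast; ring
    have h6 : (0 : ℝ) ≤ 2 ^ (m + 1) * y ^ m := by positivity
    rw [abs_le] at key ⊢
    constructor <;> nlinarith [key.1, key.2]

open ArithmeticFunction in
lemma tsum_moebius_div_pow (m : ℕ) (hm : 2 ≤ m) :
    0 < zetaVal m ∧ ∑' k : ℕ, (moebius k : ℝ) / (k : ℝ) ^ m = 1 / zetaVal m := by
  have hs : 1 < ((m : ℂ)).re := by simpa using (by omega : 1 < m)
  have h := LSeries_zeta_mul_Lseries_moebius hs
  rw [LSeries_zeta_eq_riemannZeta hs, zeta_nat_eq_tsum_of_gt_one (by omega)] at h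
  have h2 : LSeries (fun n => ((moebius n : ℤ) : ℂ)) m =
      ((∑' k : ℕ, (moebius k : ℝ) / (k : ℝ) ^ m : ℝ) : ℂ) := by
    rw [LSeries, Complex.ofReal_tsum]
    congr 1 with k
    rw [LSeries.term_def]
    split_ifs with hk
    · simp [hk]
    · simp
  have h3 : (∑' n : ℕ, 1 / (n : ℂ) ^ m) = ((zetaVal m : ℝ) : ℂ) := by
    have : zetaVal m = ∑' n : ℕ, 1 / (n : ℝ) ^ m := by
      rw [zetaVal]
      exact tsum_pnat_eq_tsum_of_eq_zero (f := fun n : ℕ => 1 / (n : ℝ) ^ m)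
        (by simp; omega)
    rw [this, Complex.ofReal_tsum]
    simp
  rw [h2, h3] at h
  rw [← Complex.ofReal_mul, Complex.ofReal_eq_one] at h
  have hpos : 0 ≤ zetaVal m := tsum_nonneg fun _ => by positivity
  have hne : zetaVal m ≠ 0 := left_ne_zero_of_mul_eq_one h
  exact ⟨lt_of_le_of_ne hpos hne.symm, by field_simp; linarith⟩

lemma sylvesterMat_single_eq_one (d : ℕ) :
    sylvesterMat d (fun i : Fin (2 * d + 2) =>
      if (i : ℕ) = 0 ∨ (i : ℕ) = 2 * d + 1 then (1 : ℤ) else 0) = 1 := by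
  ext i j
  simp only [sylvesterMat, Matrix.of_apply, Matrix.one_apply, Fin.ext_iff]
  have := i.2
  have := j.2
  split_ifs <;> first | rfl | omega

lemma resEval_eq_det (d : ℕ) {R : Type*} [CommRing R] (Q : Fin (2 * d + 2) → R) :
    resEval d Q = (sylvesterMat d Q).det := by
  rw [resEval, resPoly, AlgHom.map_det]
  congr 1
  ext i j
  simp only [sylvesterMat, AlgHom.mapMatrix_apply, Matrix.map_apply, Matrix.of_apply]
  split_ifs <;> simp

lemma resPoly_ne_zero (d : ℕ) : resPoly d ≠ 0 := by
  intro h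
  have h1 := resEval_eq_det d (fun i : Fin (2 * d + 2) =>
      if (i : ℕ) = 0 ∨ (i : ℕ) = 2 * d + 1 then (1 : ℤ) else 0)
  rw [sylvesterMat_single_eq_one, resEval, h] at h1
  simp at h1

open ArithmeticFunction in
lemma exists_abs_card_primitive_sub_le (m : ℕ) (hm : 2 ≤ m) :
    ∃ C : ℝ, 0 < C ∧ ∀ x : ℝ, 0 ≤ x →
      |(((Fintype.piFinset fun _ : Fin (m + 1) => Finset.Icc (-(⌊x⌋₊ : ℤ)) ⌊x⌋₊).filter
        (fun v => v ≠ 0 ∧ Finset.univ.gcd v = 1)).card : ℝ) -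
          (2 * x) ^ (m + 1) / zetaVal (m + 1)| ≤ C * x ^ m := by
  set K : ℝ := (m + 1) * 3 ^ m + 1 + 2 ^ (m + 1) with hK
  have hKpos : 0 < K := by positivity
  have hsum (n : ℕ) (hn : 2 ≤ n) : Summable fun k : ℕ => 1 / (k : ℝ) ^ n :=
    Real.summable_one_div_nat_pow.2 (by omega)
  have hμ (k : ℕ) : |(moebius k : ℝ)| ≤ 1 := by exact_mod_cast abs_moebius_le_one
  have hZ : 0 ≤ ∑' k : ℕ, 1 / (k : ℝ) ^ m := tsum_nonneg fun _ => by positivity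
  refine ⟨K * ((∑' k : ℕ, 1 / (k : ℝ) ^ m) + 1), by positivity, fun x hx => ?_⟩
  set a : ℕ → ℝ := fun k => (2 * (⌊x / k⌋₊ : ℝ) + 1) ^ (m + 1) - 1 with ha
  have hcard := congrArg (Int.cast (R := ℝ)) (card_box_primitive (m + 1) ⌊x⌋₊)
  have hzero (k : ℕ) (hk : k ∉ Finset.range (⌊x⌋₊ + 1)) : (moebius k : ℝ) * a k = 0 := by
    have : ⌊x / k⌋₊ = 0 := by
      rw [Nat.floor_div_natCast]
      exact Nat.div_eq_of_lt (by rw [Finset.mem_range] at hk; omega)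
    simp [ha, this]
  have hcard' : (((Fintype.piFinset fun _ : Fin (m + 1) => Finset.Icc (-(⌊x⌋₊ : ℤ)) ⌊x⌋₊).filter
        (fun v => v ≠ 0 ∧ Finset.univ.gcd v = 1)).card : ℝ) = ∑' k, (moebius k : ℝ) * a k := by
    rw [tsum_eq_sum hzero]
    push_cast at hcard
    rw [hcard]
    refine Finset.sum_congr rfl fun k _ => ?_
    rw [ha]
    simp only [Nat.floor_div_natCast, ← Int.natCast_ediv, Int.cast_natCast]
  have hmain : (2 * x) ^ (m + 1) / zetaVal (m + 1) =
      ∑' k : ℕ, (moebius k : ℝ) * (2 * (x / k)) ^ (m + 1) := by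
    rw [div_eq_mul_one_div, ← (tsum_moebius_div_pow (m + 1) (by omega)).2, ← tsum_mul_left]
    congr 1 with k
    simp only [mul_pow, div_pow]
    ring
  have hs1 : Summable fun k => (moebius k : ℝ) * a k := summable_of_ne_finset_zero hzero
  have hs2 : Summable fun k : ℕ => (moebius k : ℝ) * (2 * (x / k)) ^ (m + 1) := by
    refine Summable.of_norm_bounded ((hsum (m + 1) (by omega)).mul_left ((2 * x) ^ (m + 1)))
      fun k => ?_
    rw [Real.norm_eq_abs, abs_mul, abs_of_nonneg (by positivity : (0 : ℝ) ≤ (2 * (x / k)) ^ (m + 1))]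
    calc _ ≤ 1 * (2 * (x / k)) ^ (m + 1) := by gcongr; exact hμ k
      _ = _ := by simp only [mul_pow, div_pow]; ring
  rw [hcard', hmain, ← hs1.tsum_sub hs2, ← Real.norm_eq_abs]
  refine (tsum_of_norm_bounded ((hsum m hm).mul_left (K * x ^ m)).hasSum fun k => ?_).trans ?_
  · rw [← mul_sub, Real.norm_eq_abs, abs_mul]
    calc _ ≤ 1 * (K * (x / k) ^ m) := by
          gcongr
          · exact hμ k
          · exact abs_floor_pow_sub_le m (by positivity)
      _ = _ := by simp only [div_pow]; ring
  · rw [tsum_mul_left]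
    have : 0 ≤ K * x ^ m := by positivity
    nlinarith

lemma gcd_univ_neg {m : ℕ} (v : Fin m → ℤ) : Finset.univ.gcd (-v) = Finset.univ.gcd v := by
  have h := Finset.gcd_mul_left (s := Finset.univ) (f := v) (a := -1)
  rw [show normalize (-1 : ℤ) = 1 by decide, one_mul] at h
  simpa [Pi.neg_def] using h

lemma neg_mem_projPts_iff {d : ℕ} {v : Fin (2 * d + 2) → ℤ} (h0 : v ≠ 0)
    (h1 : Finset.univ.gcd v = 1) : -v ∈ projPts d ↔ v ∉ projPts d := by
  simp only [projPts, Set.mem_ofPred_eq, gcd_univ_neg, h1, true_and, Pi.neg_apply, neg_eq_zero,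
    Left.neg_pos_iff]
  obtain ⟨i, hi, hmin⟩ := WellFounded.has_min (wellFounded_lt (α := Fin (2 * d + 2)))
    {i | v i ≠ 0} (Function.ne_iff.mp h0)
  have hmin' : ∀ j < i, v j = 0 := fun j hj => by_contra fun h => hmin j h hj
  constructor
  · rintro ⟨j, hj, hj'⟩ ⟨k, hk, hk'⟩
    rcases lt_trichotomy j k with h | h | h
    · exact hj.ne (hk' j h)
    · subst h; omega
    · exact hk.ne' (hj' k h)
  · intro h
    refine ⟨i, lt_of_le_of_ne (not_lt.1 fun h' => h ⟨i, h', hmin'⟩) hi, hmin'⟩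

open Classical in
lemma two_mul_card_box_projPts (d N : ℕ) :
    2 * ((Fintype.piFinset fun _ : Fin (2 * d + 2) => Finset.Icc (-(N : ℤ)) N).filter
        (fun v => v ∈ projPts d)).card =
      ((Fintype.piFinset fun _ : Fin (2 * d + 2) => Finset.Icc (-(N : ℤ)) N).filter
        (fun v => v ≠ 0 ∧ Finset.univ.gcd v = 1)).card := by
  have hproj {v : Fin (2 * d + 2) → ℤ} (hv : v ∈ projPts d) :
      v ≠ 0 ∧ Finset.univ.gcd v = 1 := by
    obtain ⟨h, i, hi, -⟩ := hv
    exact ⟨fun h0 => by simp [h0] at hi, h⟩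
  rw [← Finset.card_filter_add_card_filter_not (p := fun v => v ∈ projPts d)
      (s := Finset.filter (fun v => v ≠ 0 ∧ Finset.univ.gcd v = 1) _),
    Finset.filter_filter, Finset.filter_filter, two_mul]
  congr 1
  · congr 1
    ext v
    simp only [Finset.mem_filter]
    exact ⟨fun h => ⟨h.1, hproj h.2, h.2⟩, fun h => ⟨h.1, h.2.2⟩⟩
  · have hbox {v : Fin (2 * d + 2) → ℤ}
        (hv : v ∈ Fintype.piFinset fun _ : Fin (2 * d + 2) => Finset.Icc (-(N : ℤ)) N) :
        -v ∈ Fintype.piFinset fun _ : Fin (2 * d + 2) => Finset.Icc (-(N : ℤ)) N := by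
      simp only [Fintype.mem_piFinset, Finset.mem_Icc, Pi.neg_apply] at hv ⊢
      intro i
      have := hv i
      omega
    refine Finset.card_nbij' (fun v => -v) (fun v => -v) ?_ ?_ (fun v _ => neg_neg v)
      (fun v _ => neg_neg v)
    · intro v hv
      simp only [Finset.coe_filter, Set.mem_ofPred_eq] at hv ⊢
      obtain ⟨h0, h1⟩ := hproj hv.2
      refine ⟨hbox hv.1, ⟨neg_ne_zero.2 h0, (gcd_univ_neg v).trans h1⟩, fun h => ?_⟩
      exact (neg_mem_projPts_iff h0 h1).1 h hv.2
    · intro v hv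
      simp only [Finset.coe_filter, Set.mem_ofPred_eq] at hv ⊢
      exact ⟨hbox hv.1, (neg_mem_projPts_iff hv.2.1.1 hv.2.1.2).2 hv.2.2⟩

lemma card_box_resEval_eq_zero_le (d N : ℕ) :
    ((Fintype.piFinset fun _ : Fin (2 * d + 2) => Finset.Icc (-(N : ℤ)) N).filter
      (fun v => resEval d v = 0)).card ≤ (resPoly d).totalDegree * (2 * N + 1) ^ (2 * d + 1) := by
  have h := schwartz_zippel_totalDegree (resPoly_ne_zero d) (Finset.Icc (-(N : ℤ)) N)
  have hc : (Finset.Icc (-(N : ℤ)) N).card = 2 * N + 1 := by simp; omega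
  rw [hc, div_le_div_iff₀ (by positivity) (by positivity), pow_succ, ← mul_assoc] at h
  have h := le_of_mul_le_mul_right h (by positivity)
  have heq (v : Fin (2 * d + 2) → ℤ) : resEval d v = eval v (resPoly d) := by
    rw [resEval, aeval_eq_eval]
  simp only [heq]
  exact_mod_cast h

lemma natCard_subtype_box {m : ℕ} (p : (Fin m → ℤ) → Prop) [DecidablePred p] {x : ℝ} (hx : 0 ≤ x) :
    Nat.card {Q : Fin m → ℤ // p Q ∧ ∀ i, |(Q i : ℝ)| ≤ x} =
      ((Fintype.piFinset fun _ : Fin m => Finset.Icc (-(⌊x⌋₊ : ℤ)) ⌊x⌋₊).filter p).card := by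
  refine Nat.subtype_card _ fun v => ?_
  simp only [Finset.mem_filter, Fintype.mem_piFinset, Finset.mem_Icc, ← abs_le, and_comm (a := p v)]
  refine and_congr_left fun _ => forall_congr' fun i => ?_
  rw [Int.natCast_floor_eq_floor hx, Int.le_floor, Int.cast_abs]

open Classical in
lemma exists_abs_natCard_projPts_sub_le (d : ℕ) (hd : 2 ≤ d) :
    ∃ C : ℝ, 0 < C ∧ ∀ x : ℝ, 0 ≤ x →
      |(Nat.card {Q : Fin (2 * d + 2) → ℤ // Q ∈ projPts d ∧ ∀ i, |(Q i : ℝ)| ≤ x} : ℝ) -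
          (2 * x) ^ (2 * d + 2) / (2 * zetaVal (2 * d + 2))| ≤ C * x ^ (2 * d + 1) := by
  obtain ⟨C, hC, h⟩ := exists_abs_card_primitive_sub_le (2 * d + 1) (by omega)
  refine ⟨C / 2, by positivity, fun x hx => ?_⟩
  rw [natCard_subtype_box _ hx]
  have h1 := h x hx
  rw [← two_mul_card_box_projPts d ⌊x⌋₊] at h1
  have h2 : (2 * x) ^ (2 * d + 2) / (2 * zetaVal (2 * d + 2)) =
    (2 * x) ^ (2 * d + 2) / zetaVal (2 * d + 2) / 2 := by rw [div_div, mul_comm 2 (zetaVal _)]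
  rw [h2]
  push_cast at h1
  rw [abs_le] at h1 ⊢
  constructor <;> linarith [h1.1, h1.2]

open Classical in
lemma exists_natCard_projPts_le_natCard_resEval_ne_zero_add (d : ℕ) :
    ∃ C : ℝ, 0 < C ∧ ∀ x : ℝ, 1 ≤ x →
      (Nat.card {Q : Fin (2 * d + 2) → ℤ // Q ∈ projPts d ∧ ∀ i, |(Q i : ℝ)| ≤ x} : ℝ) ≤
        (Nat.card {Q : Fin (2 * d + 2) → ℤ //
            Q ∈ projPts d ∧ resEval d Q ≠ 0 ∧ ∀ i, |(Q i : ℝ)| ≤ x} : ℝ) +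
          C * x ^ (2 * d + 1) := by
  refine ⟨((resPoly d).totalDegree + 1) * 3 ^ (2 * d + 1), by positivity, fun x hx => ?_⟩
  have hx0 : 0 ≤ x := by linarith
  simp_rw [← and_assoc]
  rw [natCard_subtype_box (fun Q => Q ∈ projPts d) hx0,
    natCard_subtype_box (fun Q => Q ∈ projPts d ∧ resEval d Q ≠ 0) hx0,
    ← Finset.card_filter_add_card_filter_not (p := fun v => resEval d v ≠ 0)
      (s := Finset.filter (fun v => v ∈ projPts d) _), Finset.filter_filter, Nat.cast_add]
  gcongr
  have h1 := Finset.card_le_card (Finset.filter_subset_filter (fun v => ¬resEval d v ≠ 0)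
    (Finset.filter_subset (fun v => v ∈ projPts d)
      (Fintype.piFinset fun _ : Fin (2 * d + 2) => Finset.Icc (-(⌊x⌋₊ : ℤ)) ⌊x⌋₊)))
  simp only [not_not] at h1 ⊢
  have h2 : _ ≤ _ := h1.trans (card_box_resEval_eq_zero_le d ⌊x⌋₊)
  calc _ ≤ (((resPoly d).totalDegree * (2 * ⌊x⌋₊ + 1) ^ (2 * d + 1) : ℕ) : ℝ) := by exact_mod_cast h2
    _ = (resPoly d).totalDegree * (2 * (⌊x⌋₊ : ℝ) + 1) ^ (2 * d + 1) := by push_cast; rfl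
    _ ≤ ((resPoly d).totalDegree + 1) * (3 * x) ^ (2 * d + 1) := by
        have := Nat.floor_le hx0
        gcongr <;> linarith
    _ = _ := by rw [mul_pow, mul_assoc]

lemma natCard_resEval_ne_zero_le_natCard_projPts (d : ℕ) {x : ℝ} (hx : 0 ≤ x) :
    Nat.card {Q : Fin (2 * d + 2) → ℤ //
        Q ∈ projPts d ∧ resEval d Q ≠ 0 ∧ ∀ i, |(Q i : ℝ)| ≤ x} ≤
      Nat.card {Q : Fin (2 * d + 2) → ℤ // Q ∈ projPts d ∧ ∀ i, |(Q i : ℝ)| ≤ x} := by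
  classical
  simp_rw [← and_assoc]
  rw [natCard_subtype_box (fun Q => Q ∈ projPts d) hx,
    natCard_subtype_box (fun Q => Q ∈ projPts d ∧ resEval d Q ≠ 0) hx]
  exact Finset.card_le_card (Finset.monotone_filter_right _ fun _ _ h => h.1)

lemma tendsto_div_pow_of_abs_sub_le {f : ℝ → ℝ} {c C : ℝ} (m : ℕ)
    (h : ∀ x : ℝ, 1 ≤ x → |f x - c * x ^ (m + 1)| ≤ C * x ^ m) :
    Tendsto (fun x => f x / x ^ (m + 1)) atTop (nhds c) := by
  refine tendsto_iff_norm_sub_tendsto_zero.2 (squeeze_zero' (.of_forall fun _ => norm_nonneg _)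
    ?_ (tendsto_const_nhds (x := C) |>.div_atTop tendsto_id))
  filter_upwards [eventually_ge_atTop 1] with x hx
  have hx0 : 0 < x := by linarith
  have hsub : f x / x ^ (m + 1) - c = (f x - c * x ^ (m + 1)) / x ^ (m + 1) := by field_simp
  rw [hsub, Real.norm_eq_abs, abs_div, abs_of_pos (pow_pos hx0 _), id,
    div_le_div_iff₀ (by positivity) hx0]
  calc _ ≤ C * x ^ m * x := by gcongr; exact h x hx
    _ = _ := by ring

/-- Schanuel-type count for `ℛ^(d)(x)` with error term, and the consequence
`#ℛ^(d)(x)/#𝒫(x) → 1`. -/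
theorem stmt_0 (d : ℕ) (hd : 2 ≤ d) :
    (∃ C : ℝ, 0 < C ∧ ∀ x : ℝ, 2 ≤ x →
      |(Nat.card {Q : Fin (2 * d + 2) → ℤ //
            Q ∈ projPts d ∧ resEval d Q ≠ 0 ∧ ∀ i, |(Q i : ℝ)| ≤ x} : ℝ) -
          (2 * x) ^ (2 * d + 2) / (2 * zetaVal (2 * d + 2))|
        ≤ C * x ^ (2 * d + 1) * Real.log x) ∧
    Tendsto (fun x : ℝ =>
        (Nat.card {Q : Fin (2 * d + 2) → ℤ //
            Q ∈ projPts d ∧ resEval d Q ≠ 0 ∧ ∀ i, |(Q i : ℝ)| ≤ x} : ℝ) /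
        (Nat.card {Q : Fin (2 * d + 2) → ℤ //
            Q ∈ projPts d ∧ ∀ i, |(Q i : ℝ)| ≤ x} : ℝ))
      atTop (nhds 1) := by
  obtain ⟨C₁, hC₁, h₁⟩ := exists_abs_natCard_projPts_sub_le d hd
  obtain ⟨C₂, hC₂, h₂⟩ := exists_natCard_projPts_le_natCard_resEval_ne_zero_add d
  have h₃ (x : ℝ) (hx : 1 ≤ x) :
      |(Nat.card {Q : Fin (2 * d + 2) → ℤ //
            Q ∈ projPts d ∧ resEval d Q ≠ 0 ∧ ∀ i, |(Q i : ℝ)| ≤ x} : ℝ) -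
          (2 * x) ^ (2 * d + 2) / (2 * zetaVal (2 * d + 2))| ≤ (C₁ + C₂) * x ^ (2 * d + 1) := by
    have hx0 : 0 ≤ x := by linarith
    have ha := h₁ x hx0
    have hb := h₂ x hx
    have hc : (_ : ℝ) ≤ _ := Nat.cast_le.2 (natCard_resEval_ne_zero_le_natCard_projPts d hx0)
    have hp : 0 ≤ C₂ * x ^ (2 * d + 1) := by positivity
    rw [add_mul]
    rw [abs_le] at ha ⊢
    constructor <;> linarith [ha.1, ha.2]
  refine ⟨⟨(C₁ + C₂) / Real.log 2, by positivity, fun x hx => (h₃ x (by linarith)).trans ?_⟩, ?_⟩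
  · have hlog : 0 < Real.log 2 := by positivity
    have hle : Real.log 2 ≤ Real.log x := Real.log_le_log (by norm_num) hx
    calc (C₁ + C₂) * x ^ (2 * d + 1)
        = (C₁ + C₂) / Real.log 2 * x ^ (2 * d + 1) * Real.log 2 := by field_simp
      _ ≤ _ := by gcongr
  · have hz := (tsum_moebius_div_pow (2 * d + 2) (by omega)).1
    have hmain (x : ℝ) : (2 * x) ^ (2 * d + 2) / (2 * zetaVal (2 * d + 2)) =
        2 ^ (2 * d + 2) / (2 * zetaVal (2 * d + 2)) * x ^ (2 * d + 1 + 1) := by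
      rw [mul_pow]; ring
    simp only [hmain] at h₁ h₃
    have hA := tendsto_div_pow_of_abs_sub_le _ h₃
    have hB := tendsto_div_pow_of_abs_sub_le _ fun x hx => h₁ x (by linarith)
    have hdiv := hA.div hB (by positivity)
    rw [div_self (by positivity)] at hdiv
    refine hdiv.congr' ?_
    filter_upwards [eventually_gt_atTop 0] with x hx
    exact div_div_div_cancel_right₀ (by positivity) _ _
end
end

section
/- Fix an integer d ≥ 2. Along the filter in which every coordinate r_1,…,r_{2d+2} tends to infinity, the ratio #𝒫(r⃗)/#Box(r⃗) converges to 1/(2ζ(2d+2)), where ζ is the Riemann zeta function. -/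
open Filter MvPolynomial

noncomputable section

open ArithmeticFunction in
/-- The Möbius function summed over the divisors of `g` detects `g = 1`. -/
lemma sum_Icc_moebius_of_dvd {g N : ℕ} (hg : 0 < g) (hN : g ≤ N) :
    ∑ k ∈ Finset.Icc 1 N, (if k ∣ g then moebius k else 0) = if g = 1 then 1 else 0 := by
  rw [← Finset.sum_filter]
  have h : (Finset.Icc 1 N).filter (· ∣ g) = g.divisors := by
    ext k
    simp only [Finset.mem_filter, Finset.mem_Icc, Nat.mem_divisors]
    constructor
    · rintro ⟨-, h⟩
      exact ⟨h, hg.ne'⟩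
    · rintro ⟨h, -⟩
      exact ⟨⟨Nat.pos_of_dvd_of_pos h hg, (Nat.le_of_dvd hg h).trans hN⟩, h⟩
  rw [h, ← coe_mul_zeta_apply, moebius_mul_coe_zeta, one_apply]

lemma card_filter_dvd_Icc_one (n k : ℕ) :
    ((Finset.Icc (1 : ℤ) n).filter ((k : ℤ) ∣ ·)).card = n / k := by
  rw [← Nat.Ioc_filter_dvd_card_eq_div]
  symm
  refine Finset.card_bij (fun a _ => (a : ℤ)) ?_ ?_ ?_
  · intro a ha
    simp only [Finset.mem_filter, Finset.mem_Ioc, Finset.mem_Icc] at ha ⊢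
    exact ⟨by omega, Int.natCast_dvd_natCast.2 ha.2⟩
  · intro a _ b _ h
    exact_mod_cast h
  · intro b hb
    simp only [Finset.mem_filter, Finset.mem_Icc] at hb
    lift b to ℕ using by omega
    refine ⟨b, ?_, rfl⟩
    simp only [Finset.mem_filter, Finset.mem_Ioc]
    exact ⟨by omega, Int.natCast_dvd_natCast.1 hb.2⟩

lemma card_filter_dvd_Icc_neg_erase_zero (n k : ℕ) :
    (((Finset.Icc (-n : ℤ) n).erase 0).filter ((k : ℤ) ∣ ·)).card = 2 * (n / k) := by
  have h : ((Finset.Icc (-n : ℤ) n).erase 0).filter ((k : ℤ) ∣ ·) =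
      (Finset.Icc (1 : ℤ) n).filter ((k : ℤ) ∣ ·) ∪
        ((Finset.Icc (1 : ℤ) n).filter ((k : ℤ) ∣ ·)).map (Equiv.neg ℤ).toEmbedding := by
    ext x
    simp only [Finset.mem_filter, Finset.mem_erase, Finset.mem_Icc, Finset.mem_union,
      Finset.mem_map_equiv, Equiv.neg_symm, Equiv.neg_apply, dvd_neg]
    by_cases hx : (k : ℤ) ∣ x
    · simp only [hx, and_true]
      omega
    · simp [hx]
  rw [h, Finset.card_union_of_disjoint, Finset.card_map, card_filter_dvd_Icc_one, two_mul]
  rw [Finset.disjoint_left]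
  intro x hx hx'
  simp only [Finset.mem_filter, Finset.mem_Icc, Finset.mem_map_equiv, Equiv.neg_symm,
    Equiv.neg_apply] at hx hx'
  omega

/-- Nonzero integers of absolute value at most `n`, required to be positive when `i = 0`. -/
def nonzeroRange {m : ℕ} (i : Fin (m + 1)) (n : ℕ) : Finset ℤ :=
  if i = 0 then Finset.Icc 1 n else (Finset.Icc (-n : ℤ) n).erase 0

lemma card_filter_dvd_nonzeroRange {m : ℕ} (i : Fin (m + 1)) (n k : ℕ) :
    ((nonzeroRange i n).filter ((k : ℤ) ∣ ·)).card = (if i = 0 then 1 else 2) * (n / k) := by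
  unfold nonzeroRange
  split_ifs
  · rw [card_filter_dvd_Icc_one, one_mul]
  · exact card_filter_dvd_Icc_neg_erase_zero n k

/-- Primitive tuples in a box, all of whose coordinates are nonzero and whose first coordinate
is positive. -/
def primitiveNonzero {m : ℕ} (n : Fin (m + 1) → ℕ) : Finset (Fin (m + 1) → ℤ) :=
  (Fintype.piFinset fun i => nonzeroRange i (n i)).filter (Finset.univ.gcd · = 1)

open ArithmeticFunction in
lemma card_primitiveNonzero {m : ℕ} (n : Fin (m + 1) → ℕ) :
    ((primitiveNonzero n).card : ℤ) = ∑ k ∈ Finset.Icc 1 (n 0),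
      moebius k * ∏ i, (((if i = 0 then 1 else 2) * (n i / k) : ℕ) : ℤ) := by
  have h1 : ∀ x ∈ Fintype.piFinset fun i => nonzeroRange i (n i),
      (if Finset.univ.gcd x = 1 then (1 : ℤ) else 0) =
        ∑ k ∈ Finset.Icc 1 (n 0), if ∀ i, (k : ℤ) ∣ x i then moebius k else 0 := by
    intro x hx
    have hx0 := Fintype.mem_piFinset.1 hx 0
    simp only [nonzeroRange, if_true, Finset.mem_Icc] at hx0
    have hdvd : Finset.univ.gcd x ∣ x 0 := Finset.gcd_dvd (Finset.mem_univ _)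
    have hnonneg : 0 ≤ Finset.univ.gcd x := by
      rw [← Finset.normalize_gcd]
      exact Int.nonneg_of_normalize_eq_self (normalize_idem _)
    obtain ⟨g, hg⟩ := Int.eq_ofNat_of_zero_le hnonneg
    have hle : (g : ℤ) ≤ x 0 := hg ▸ Int.le_of_dvd (by omega) hdvd
    have hpos : 0 < g := by
      rcases Nat.eq_zero_or_pos g with rfl | h
      · rw [hg] at hdvd
        have := zero_dvd_iff.1 hdvd
        omega
      · exact h
    have hk : ∀ k : ℕ, (∀ i, (k : ℤ) ∣ x i) ↔ k ∣ g := by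
      intro k
      rw [← Int.natCast_dvd_natCast, ← hg, Finset.dvd_gcd_iff]
      simp
    simp only [hk, hg, Nat.cast_eq_one]
    exact (sum_Icc_moebius_of_dvd hpos (by omega)).symm
  rw [primitiveNonzero, Finset.card_filter]
  push_cast
  rw [Finset.sum_congr rfl h1, Finset.sum_comm]
  refine Finset.sum_congr rfl fun k _ => ?_
  rw [← Finset.sum_filter, Finset.sum_const, nsmul_eq_mul, mul_comm]
  congr 1
  have h2 : (Fintype.piFinset fun i => nonzeroRange i (n i)).filter (fun x => ∀ i, (k : ℤ) ∣ x i) =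
      Fintype.piFinset fun i => (nonzeroRange i (n i)).filter ((k : ℤ) ∣ ·) := by
    ext x
    simp [Fintype.mem_piFinset, forall_and]
  rw [h2, Fintype.card_piFinset]
  simp only [card_filter_dvd_nonzeroRange]
  push_cast
  rfl

open ArithmeticFunction in
lemma card_primitiveNonzero_div {m : ℕ} (n : Fin (m + 1) → ℕ) :
    ((primitiveNonzero n).card : ℝ) / ∏ i, (2 * (n i : ℝ) + 1) =
      ∑' k : ℕ, (moebius k : ℝ) *
        ∏ i, ((if i = 0 then 1 else 2) * ((n i / k : ℕ) : ℝ) / (2 * (n i : ℝ) + 1)) := by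
  have h : ((primitiveNonzero n).card : ℝ) = ∑ k ∈ Finset.Icc 1 (n 0),
      (moebius k : ℝ) * ∏ i, ((if i = 0 then 1 else 2) * ((n i / k : ℕ) : ℝ)) := by
    have := congrArg (Int.cast : ℤ → ℝ) (card_primitiveNonzero n)
    simpa [-Int.natCast_ediv] using this
  rw [tsum_eq_sum (s := Finset.Icc 1 (n 0)), h, Finset.sum_div]
  · refine Finset.sum_congr rfl fun k _ => ?_
    rw [Finset.prod_div_distrib, mul_div_assoc]
  · intro k hk
    rcases Nat.eq_zero_or_pos k with rfl | hk0
    · simp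
    · have : n 0 / k = 0 := Nat.div_eq_of_lt (by simp at hk; omega)
      rw [Finset.prod_eq_zero (Finset.mem_univ 0), mul_zero]
      simp [this]

lemma tendsto_natDiv_div_two_mul_add_one (k : ℕ) (c : ℝ) :
    Tendsto (fun n : ℕ => c * ((n / k : ℕ) : ℝ) / (2 * (n : ℝ) + 1)) atTop
      (nhds (c / 2 * (1 / k))) := by
  have h1 : Tendsto (fun n : ℕ => ((n / k : ℕ) : ℝ) / (n : ℝ)) atTop (nhds (1 / k)) := by
    have := (tendsto_nat_floor_mul_div_atTop (R := ℝ) (a := 1 / k) (by positivity)).comp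
      tendsto_natCast_atTop_atTop
    refine this.congr fun n => ?_
    simp only [Function.comp_apply]
    rw [one_div_mul_eq_div, Nat.floor_div_eq_div]
  have h2 : Tendsto (fun n : ℕ => (n : ℝ) / (2 * (n : ℝ) + 1)) atTop (nhds (1 / 2)) := by
    have h3 : Tendsto (fun n : ℕ => (2 + (n : ℝ)⁻¹)⁻¹) atTop (nhds (2 + 0)⁻¹) :=
      (tendsto_inv_atTop_nhds_zero_nat.const_add 2).inv₀ (by norm_num)
    rw [add_zero, inv_eq_one_div] at h3
    refine h3.congr' ?_
    filter_upwards [eventually_gt_atTop 0] with n hn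
    have : (0 : ℝ) < n := by exact_mod_cast hn
    field_simp
  have h := (h1.mul h2).const_mul c
  rw [show c / 2 * (1 / (k : ℝ)) = c * (1 / k * (1 / 2)) by ring]
  refine h.congr' ?_
  filter_upwards [eventually_gt_atTop 0] with n hn
  have : (0 : ℝ) < n := by exact_mod_cast hn
  field_simp

lemma tendsto_two_mul_div_two_mul_add_one :
    Tendsto (fun n : ℕ => 2 * (n : ℝ) / (2 * (n : ℝ) + 1)) atTop (nhds 1) := by
  simpa using tendsto_natDiv_div_two_mul_add_one 1 2

lemma mul_natDiv_div_two_mul_add_one_le (n k : ℕ) {c : ℝ} (hc : c ≤ 2) :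
    c * ((n / k : ℕ) : ℝ) / (2 * (n : ℝ) + 1) ≤ 1 / k := by
  have h1 : ((n / k : ℕ) : ℝ) ≤ n / k := Nat.cast_div_le
  rw [div_le_iff₀ (by positivity)]
  calc c * ((n / k : ℕ) : ℝ) ≤ 2 * (n / k) := by gcongr
    _ = 1 / k * (2 * n) := by ring
    _ ≤ 1 / k * (2 * n + 1) := by gcongr; linarith

lemma prod_ite_div_two_mul (m : ℕ) (a : ℝ) :
    ∏ i : Fin (m + 1), ((if i = 0 then 1 else 2) / 2 * a) = 1 / 2 * a ^ (m + 1) := by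
  rw [Fin.prod_univ_succ]
  simp [pow_succ]
  ring

open ArithmeticFunction in
lemma tendsto_card_primitiveNonzero_div {m : ℕ} (hm : 1 ≤ m) {α : Type*} {l : Filter α}
    (n : α → Fin (m + 1) → ℕ) (hn : ∀ i, Tendsto (fun a => n a i) l atTop) :
    Tendsto (fun a => ((primitiveNonzero (n a)).card : ℝ) / ∏ i, (2 * (n a i : ℝ) + 1)) l
      (nhds (1 / 2 * ∑' k : ℕ, (moebius k : ℝ) * (1 / (k : ℝ)) ^ (m + 1))) := by
  simp only [card_primitiveNonzero_div]
  rw [← tsum_mul_left]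
  refine tendsto_tsum_of_dominated_convergence (bound := fun k : ℕ => (1 / (k : ℝ)) ^ (m + 1))
    ?_ ?_ ?_
  · simp only [one_div, inv_pow]
    exact Real.summable_nat_pow_inv.2 (by omega)
  · intro k
    rw [mul_left_comm, ← prod_ite_div_two_mul]
    refine Tendsto.const_mul _ (tendsto_finsetProd _ fun i _ => ?_)
    exact (tendsto_natDiv_div_two_mul_add_one k _).comp (hn i)
  · refine Eventually.of_forall fun a k => ?_
    rw [norm_mul]
    have h1 : ‖(moebius k : ℝ)‖ ≤ 1 := by
      rw [Real.norm_eq_abs]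
      exact_mod_cast abs_moebius_le_one (n := k)
    have hnonneg : ∀ i : Fin (m + 1),
        0 ≤ (if i = 0 then (1 : ℝ) else 2) * ((n a i / k : ℕ) : ℝ) / (2 * (n a i : ℝ) + 1) := by
      intro i
      have : (0 : ℝ) ≤ if i = 0 then 1 else 2 := by split_ifs <;> norm_num
      positivity
    have h2 : ‖∏ i : Fin (m + 1),
        ((if i = 0 then (1 : ℝ) else 2) * ((n a i / k : ℕ) : ℝ) / (2 * (n a i : ℝ) + 1))‖ ≤
          (1 / (k : ℝ)) ^ (m + 1) := by
      rw [Real.norm_of_nonneg (Finset.prod_nonneg fun i _ => hnonneg i)]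
      calc _ ≤ ∏ _i : Fin (m + 1), (1 / (k : ℝ)) :=
            Finset.prod_le_prod (fun i _ => hnonneg i) fun i _ =>
              mul_natDiv_div_two_mul_add_one_le _ _ (by split_ifs <;> norm_num)
        _ = _ := by simp
    calc _ ≤ 1 * (1 / (k : ℝ)) ^ (m + 1) := mul_le_mul h1 h2 (norm_nonneg _) zero_le_one
      _ = _ := one_mul _

open ArithmeticFunction in
lemma tsum_moebius_mul_pow_eq_inv_zetaVal {s : ℕ} (hs : 1 < s) :
    ∑' k : ℕ, (moebius k : ℝ) * (1 / (k : ℝ)) ^ s = 1 / zetaVal s := by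
  have hre : 1 < (s : ℂ).re := by simpa using hs
  have hz : (zetaVal s : ℂ) = LSeries 1 s := by
    rw [LSeries_one_eq_riemannZeta hre, zeta_nat_eq_tsum_of_gt_one hs, zetaVal,
      tsum_pnat_eq_tsum_of_eq_zero (f := fun n : ℕ => (1 : ℝ) / (n : ℝ) ^ s) (by simp; omega)]
    push_cast
    rfl
  have hmu : ((∑' k : ℕ, (moebius k : ℝ) * (1 / (k : ℝ)) ^ s : ℝ) : ℂ) =
      LSeries (fun k => (moebius k : ℂ)) s := by
    rw [LSeries, Complex.ofReal_tsum]
    refine tsum_congr fun k => ?_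
    rcases eq_or_ne k 0 with rfl | hk
    · simp
    · rw [LSeries.term_of_ne_zero hk, Complex.cpow_natCast]
      push_cast
      rw [div_pow, one_pow, mul_one_div]
  have h : (zetaVal s : ℂ) * ((∑' k : ℕ, (moebius k : ℝ) * (1 / (k : ℝ)) ^ s : ℝ) : ℂ) = 1 := by
    rw [hz, hmu]
    exact LSeries_one_mul_Lseries_moebius hre
  have h' : zetaVal s * ∑' k : ℕ, (moebius k : ℝ) * (1 / (k : ℝ)) ^ s = 1 := by exact_mod_cast h
  exact eq_one_div_of_mul_eq_one_right h'

/-- The integer points of the box with real side lengths `r ≥ 0`, as a finset. -/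
lemma box_eq_coe_piFinset {m : ℕ} {r : Fin m → ℝ} (hr : ∀ i, 0 ≤ r i) :
    box r = ↑(Fintype.piFinset fun i => Finset.Icc (-⌊r i⌋₊ : ℤ) ⌊r i⌋₊) := by
  ext x
  simp only [box, Set.mem_ofPred_eq, Finset.mem_coe, Fintype.mem_piFinset, Finset.mem_Icc]
  refine forall_congr' fun i => ?_
  rw [← Int.cast_abs, Int.abs_eq_natAbs, Int.cast_natCast, ← Nat.le_floor_iff (hr i)]
  omega

lemma card_box {m : ℕ} {r : Fin m → ℝ} (hr : ∀ i, 0 ≤ r i) :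
    (Nat.card (box r) : ℝ) = ∏ i, (2 * (⌊r i⌋₊ : ℝ) + 1) := by
  rw [box_eq_coe_piFinset hr, Nat.card_coe_set_eq, Set.ncard_coe_finset, Fintype.card_piFinset]
  push_cast
  refine Finset.prod_congr rfl fun i _ => ?_
  rw [Int.card_Icc, show ((⌊r i⌋₊ : ℤ) + 1 - -(⌊r i⌋₊ : ℤ)).toNat = 2 * ⌊r i⌋₊ + 1 by omega]
  push_cast
  rfl

/-- Tuples in a box all of whose coordinates are nonzero. -/
def allNonzero {m : ℕ} (n : Fin m → ℕ) : Finset (Fin m → ℤ) :=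
  Fintype.piFinset fun i => (Finset.Icc (-n i : ℤ) (n i)).erase 0

lemma card_allNonzero {m : ℕ} (n : Fin m → ℕ) :
    ((allNonzero n).card : ℝ) = ∏ i, (2 * (n i : ℝ)) := by
  rw [allNonzero, Fintype.card_piFinset]
  push_cast
  refine Finset.prod_congr rfl fun i _ => ?_
  have := card_filter_dvd_Icc_neg_erase_zero (n i) 1
  simp only [Nat.cast_one, one_dvd, Finset.filter_true, Nat.div_one] at this
  rw [this]
  push_cast
  rfl

lemma projPts_inter_box_eq (d : ℕ) {r : Fin (2 * d + 2) → ℝ} (hr : ∀ i, 0 ≤ r i) :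
    projPts d ∩ box r ∩ ↑(allNonzero fun i => ⌊r i⌋₊) =
      ↑(primitiveNonzero (m := 2 * d + 1) fun i => ⌊r i⌋₊) := by
  rw [box_eq_coe_piFinset hr]
  ext x
  simp only [projPts, Set.mem_inter_iff, Set.mem_ofPred_eq, Finset.mem_coe, Fintype.mem_piFinset,
    allNonzero, primitiveNonzero, nonzeroRange, Finset.mem_filter]
  constructor
  · rintro ⟨⟨⟨hg, i, hi, hlt⟩, hbox⟩, hne⟩
    refine ⟨fun j => ?_, hg⟩
    split_ifs with hj
    · subst hj
      have hi0 : i = 0 := by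
        by_contra h
        exact (Finset.mem_erase.1 (hne 0)).1 (hlt 0 (Fin.pos_iff_ne_zero.2 h))
      subst hi0
      have := Finset.mem_Icc.1 (hbox 0)
      exact Finset.mem_Icc.2 ⟨hi, this.2⟩
    · exact hne j
  · rintro ⟨h, hg⟩
    have h0 := h 0
    simp only [if_true, Finset.mem_Icc] at h0
    have hne : ∀ i, x i ∈ (Finset.Icc (-⌊r i⌋₊ : ℤ) ⌊r i⌋₊).erase 0 := by
      intro i
      have := h i
      split_ifs at this with hi
      · subst hi
        simp only [Finset.mem_erase, Finset.mem_Icc] at this ⊢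
        omega
      · exact this
    exact ⟨⟨⟨hg, 0, by omega, fun j hj => absurd hj (Fin.not_lt_zero j)⟩,
      fun i => (Finset.mem_erase.1 (hne i)).2⟩, hne⟩

lemma card_projPts_inter_box_bounds (d : ℕ) {r : Fin (2 * d + 2) → ℝ} (hr : ∀ i, 0 ≤ r i) :
    ((primitiveNonzero (m := 2 * d + 1) fun i => ⌊r i⌋₊).card : ℝ) ≤
        Nat.card ↥(projPts d ∩ box r) ∧
      (Nat.card ↥(projPts d ∩ box r) : ℝ) ≤
        (primitiveNonzero (m := 2 * d + 1) fun i => ⌊r i⌋₊).card +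
          (Nat.card ↥(box r) - (allNonzero fun i => ⌊r i⌋₊).card) := by
  have hfin : (box r).Finite := by
    rw [box_eq_coe_piFinset hr]
    exact Finset.finite_toSet _
  have hsub : (↑(allNonzero fun i => ⌊r i⌋₊) : Set (Fin (2 * d + 2) → ℤ)) ⊆ box r := by
    rw [box_eq_coe_piFinset hr, Finset.coe_subset]
    exact Fintype.piFinset_subset _ _ fun i => Finset.erase_subset _ _
  have hsplit := Set.ncard_inter_add_ncard_sdiff_eq_ncard (projPts d ∩ box r)
    ↑(allNonzero fun i => ⌊r i⌋₊) (hfin.inter_of_right _)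
  have hdiff := Set.ncard_sdiff_add_ncard_of_subset hsub hfin
  have hle : ((projPts d ∩ box r) \ ↑(allNonzero fun i => ⌊r i⌋₊)).ncard ≤
      (box r \ ↑(allNonzero fun i => ⌊r i⌋₊)).ncard :=
    Set.ncard_le_ncard (Set.sdiff_subset_sdiff_left Set.inter_subset_right) hfin.sdiff
  rw [projPts_inter_box_eq d hr, Set.ncard_coe_finset] at hsplit
  rw [Set.ncard_coe_finset] at hdiff
  simp only [Nat.card_coe_set_eq]
  rw [← hsplit, ← hdiff]
  push_cast
  have hle' := (Nat.cast_le (α := ℝ)).2 hle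
  constructor
  · simp
  · linarith

/-- box version of Schanuel's theorem:
`#𝒫(r⃗)/#Box(r⃗) → 1/(2ζ(2d+2))` as all coordinates of `r⃗` tend to infinity. -/
theorem stmt_1 (d : ℕ) (hd : 2 ≤ d) :
    Tendsto (fun r : Fin (2 * d + 2) → ℝ =>
        (Nat.card ↥(projPts d ∩ box r) : ℝ) / (Nat.card ↥(box r) : ℝ))
      atTop (nhds (1 / (2 * zetaVal (2 * d + 2)))) := by
  have hfloor : ∀ i, Tendsto (fun r : Fin (2 * d + 2) → ℝ => ⌊r i⌋₊) atTop atTop := fun i =>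
    tendsto_nat_floor_atTop.comp <| tendsto_atTop.2 fun b =>
      (eventually_ge_atTop fun _ => b).mono fun r h => h i
  have hmain := tendsto_card_primitiveNonzero_div (m := 2 * d + 1) (by omega)
    (fun (r : Fin (2 * d + 2) → ℝ) i => ⌊r i⌋₊) hfloor
  rw [tsum_moebius_mul_pow_eq_inv_zetaVal (by omega), one_div_mul_one_div] at hmain
  have hnonzero : Tendsto (fun r : Fin (2 * d + 2) → ℝ =>
      ∏ i, (2 * (⌊r i⌋₊ : ℝ) / (2 * (⌊r i⌋₊ : ℝ) + 1))) atTop (nhds 1) := by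
    have := tendsto_finsetProd Finset.univ fun i _ =>
      tendsto_two_mul_div_two_mul_add_one.comp (hfloor i)
    simpa using this
  have hupper := hmain.add (hnonzero.const_sub 1)
  rw [sub_self, add_zero] at hupper
  refine tendsto_of_tendsto_of_tendsto_of_le_of_le' hmain hupper ?_ ?_
  · filter_upwards [eventually_ge_atTop 0] with r hr
    rw [card_box hr]
    exact div_le_div_of_nonneg_right (card_projPts_inter_box_bounds d hr).1 (by positivity)
  · filter_upwards [eventually_ge_atTop 0] with r hr
    have h := (card_projPts_inter_box_bounds d hr).2
    rw [card_box hr, card_allNonzero] at h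
    have hpos : 0 < ∏ i, (2 * (⌊r i⌋₊ : ℝ) + 1) := Finset.prod_pos fun i _ => by positivity
    rw [card_box hr, Finset.prod_div_distrib, one_sub_div hpos.ne', ← add_div]
    exact div_le_div_of_nonneg_right h hpos.le
end
end

section
/- Let m ≥ 2 be an integer. For each prime p let n_p ≥ 1 be an integer and S̄_p ⊆ (ℤ/p^{n_p}ℤ)^m; let S_p ⊆ ℤ^m be the preimage of S̄_p under coordinatewise reduction mod p^{n_p}, let S := ⋂_p S_p, and set π(S_p) := #S̄_p / p^{m·n_p}. For Z > 0 let S'_{>Z} := ⋃_{p>Z} (ℤ^m \ S_p), the union over primes p > Z. Assume the admissibility condition: lim_{Z→∞} of the limsup, as all coordinates r_1,…,r_m tend to infinity, of #(S'_{>Z} ∩ Box(r⃗))/#Box(r⃗) equals 0. Then, as all coordinates r_1,…,r_m tend to infinity, #(S ∩ Box(r⃗))/#Box(r⃗) converges to ∏_p π(S_p), where the infinite product over all primes is defined as the limit of the partial products ∏_{p≤Z} π(S_p) as Z → ∞ (this limit exists since each factor lies in [0,1]). -/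
open Filter MvPolynomial

noncomputable section

/-- The box as a finite set. -/
def boxFinset {m : ℕ} (r : Fin m → ℝ) : Finset (Fin m → ℤ) :=
  Fintype.piFinset fun i => Finset.Icc (-⌊r i⌋) ⌊r i⌋

theorem coe_boxFinset {m : ℕ} (r : Fin m → ℝ) : (boxFinset r : Set (Fin m → ℤ)) = box r := by
  ext x
  simp only [boxFinset, box, Finset.mem_coe, Fintype.mem_piFinset, Finset.mem_Icc,
    Set.mem_ofPred_eq]
  refine forall_congr' fun i => ?_
  rw [abs_le, Int.le_floor, neg_le, Int.le_floor, Int.cast_neg, neg_le]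

theorem natCard_inter_box {m : ℕ} (A : Set (Fin m → ℤ)) [DecidablePred (· ∈ A)] (r : Fin m → ℝ) :
    Nat.card ↥(A ∩ box r) = ((boxFinset r).filter (· ∈ A)).card := by
  rw [← coe_boxFinset, Nat.card_coe_set_eq, ← Set.ncard_coe_finset]
  congr 1
  ext x
  simp [and_comm]

theorem natCard_box {m : ℕ} (r : Fin m → ℝ) :
    Nat.card ↥(box r) = (boxFinset r).card := by
  rw [← coe_boxFinset, Nat.card_coe_set_eq, Set.ncard_coe_finset]

/-- The proportion of points of the box that lie in `A`. -/
def boxRatio {m : ℕ} (A : Set (Fin m → ℤ)) (r : Fin m → ℝ) : ℝ :=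
  (Nat.card ↥(A ∩ box r) : ℝ) / (Nat.card ↥(box r) : ℝ)

theorem boxRatio_nonneg {m : ℕ} (A : Set (Fin m → ℤ)) (r : Fin m → ℝ) : 0 ≤ boxRatio A r := by
  unfold boxRatio; positivity

theorem boxRatio_le_one {m : ℕ} (A : Set (Fin m → ℤ)) (r : Fin m → ℝ) : boxRatio A r ≤ 1 := by
  classical
  unfold boxRatio
  rw [natCard_inter_box, natCard_box]
  refine div_le_one_of_le₀ ?_ (by positivity)
  exact_mod_cast Finset.card_filter_le _ _

theorem boxRatio_mono {m : ℕ} {A B : Set (Fin m → ℤ)} (h : A ⊆ B) (r : Fin m → ℝ) :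
    boxRatio A r ≤ boxRatio B r := by
  classical
  unfold boxRatio
  rw [natCard_inter_box, natCard_inter_box]
  gcongr

theorem boxRatio_le_add {m : ℕ} {A B C : Set (Fin m → ℤ)} (h : A ⊆ B ∪ C) (r : Fin m → ℝ) :
    boxRatio A r ≤ boxRatio B r + boxRatio C r := by
  classical
  unfold boxRatio
  rw [natCard_inter_box, natCard_inter_box, natCard_inter_box, ← add_div]
  gcongr
  norm_cast
  refine le_trans (Finset.card_le_card ?_) (Finset.card_union_le _ _)
  intro x hx
  rw [← Finset.filter_or]
  rw [Finset.mem_filter] at hx ⊢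
  exact ⟨hx.1, h hx.2⟩

/-- A residue class modulo `N` has density `1 / N` in symmetric intervals. -/
theorem tendsto_card_residueClass_Icc (N : ℕ) [NeZero N] (c : ZMod N) :
    Tendsto (fun r : ℝ =>
      (((Finset.Icc (-⌊r⌋) ⌊r⌋).filter fun x : ℤ => (x : ZMod N) = c).card : ℝ) /
        ((Finset.Icc (-⌊r⌋) ⌊r⌋).card : ℝ)) atTop (nhds (1 / (N : ℝ))) := by
  have hN : 0 < N := Nat.pos_of_ne_zero (NeZero.ne N)
  obtain ⟨v, rfl⟩ := ZMod.intCast_surjective c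
  have hfl : Tendsto (fun r : ℝ => 1 / (2 * (⌊r⌋ : ℝ) + 1)) atTop (nhds 0) := by
    refine Tendsto.div_atTop tendsto_const_nhds (tendsto_atTop_add_const_right _ _ ?_)
    exact ((tendsto_intCast_atTop_atTop (R := ℝ)).comp tendsto_floor_atTop).const_mul_atTop
      two_pos
  rw [tendsto_iff_norm_sub_tendsto_zero]
  refine squeeze_zero' (Eventually.of_forall fun _ => norm_nonneg _) ?_ hfl
  filter_upwards [eventually_ge_atTop 0] with r hr
  have hk : 0 ≤ ⌊r⌋ := Int.floor_nonneg.2 hr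
  generalize ⌊r⌋ = k at hk
  have hIcc : Finset.Icc (-k) k = Finset.Ioc (-k - 1) k := by
    ext x; simp only [Finset.mem_Icc, Finset.mem_Ioc]; omega
  have hcard : ((Finset.Icc (-k) k).card : ℝ) = 2 * k + 1 := by
    have : ((Finset.Icc (-k) k).card : ℤ) = 2 * k + 1 := by
      rw [Int.card_Icc]; omega
    exact_mod_cast this
  have hcount := Int.Ioc_filter_modEq_card (-k - 1) k (r := (N : ℤ)) (by exact_mod_cast hN) v
  have hfilter : (Finset.Icc (-k) k).filter (fun x : ℤ => (x : ZMod N) = (v : ZMod N)) =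
      (Finset.Ioc (-k - 1) k).filter (fun x : ℤ => x ≡ v [ZMOD N]) := by
    rw [hIcc]
    exact Finset.filter_congr fun x _ => ZMod.intCast_eq_intCast_iff x v N
  rw [hcard, hfilter]
  generalize ((Finset.Ioc (-k - 1) k).filter (fun x : ℤ => x ≡ v [ZMOD N])).card = q at hcount
  have hNQ : (0 : ℚ) < N := by exact_mod_cast hN
  set a : ℚ := ((k : ℚ) - v) / (N : ℚ) with ha
  set b : ℚ := (-(k : ℚ) - 1 - v) / (N : ℚ) with hb
  have hab : a - b = (2 * k + 1) / N := by rw [ha, hb]; field_simp; ring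
  have hkQ : (0 : ℚ) ≤ k := by exact_mod_cast hk
  have hba : b ≤ a := by
    have : 0 ≤ a - b := by rw [hab]; positivity
    linarith
  have hq : (q : ℤ) = ⌊a⌋ - ⌊b⌋ := by
    rw [max_eq_left] at hcount
    · rw [hcount, ha, hb]; push_cast; rfl
    · have := Int.floor_le_floor hba
      rw [ha, hb] at this
      push_cast
      omega
  have hqQ : (q : ℚ) = ⌊a⌋ - ⌊b⌋ := by exact_mod_cast hq
  have hdist : |(q : ℚ) - (2 * k + 1) / N| ≤ 1 := by
    rw [← hab, hqQ, abs_le]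
    have := Int.floor_le a
    have := Int.floor_le b
    have := Int.lt_floor_add_one a
    have := Int.lt_floor_add_one b
    constructor <;> linarith
  have hdistR : |(q : ℝ) - (2 * k + 1) / N| ≤ 1 := by exact_mod_cast hdist
  have hkR : (0 : ℝ) < 2 * k + 1 := by
    have : (0 : ℝ) ≤ k := by exact_mod_cast hk
    linarith
  have heq : (q : ℝ) / (2 * k + 1) - 1 / N = (q - (2 * k + 1) / N) / (2 * k + 1) := by
    field_simp
  rw [heq, Real.norm_eq_abs, abs_div, abs_of_pos hkR]
  gcongr

theorem tendsto_eval_atTop {m : ℕ} (i : Fin m) :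
    Tendsto (fun r : Fin m → ℝ => r i) atTop atTop := by
  refine tendsto_atTop.2 fun b => ?_
  filter_upwards [eventually_ge_atTop (fun _ : Fin m => b)] with r hr using hr i

theorem tendsto_boxRatio_residueClass {m : ℕ} (N : ℕ) [NeZero N] (c : Fin m → ZMod N) :
    Tendsto (boxRatio {x : Fin m → ℤ | ∀ i, (x i : ZMod N) = c i}) atTop
      (nhds ((1 / (N : ℝ)) ^ m)) := by
  classical
  have h : boxRatio {x : Fin m → ℤ | ∀ i, (x i : ZMod N) = c i} = fun r => ∏ i : Fin m,
      ((((Finset.Icc (-⌊r i⌋) ⌊r i⌋).filter fun x : ℤ => (x : ZMod N) = c i).card : ℝ) /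
        ((Finset.Icc (-⌊r i⌋) ⌊r i⌋).card : ℝ)) := by
    funext r
    unfold boxRatio
    rw [natCard_inter_box, natCard_box, Finset.prod_div_distrib]
    congr 1
    · rw [← Nat.cast_prod, ← Fintype.card_piFinset]
      congr 2
      ext x
      simp [boxFinset, forall_and]
    · rw [← Nat.cast_prod, boxFinset, Fintype.card_piFinset]
  rw [h]
  have := tendsto_finsetProd (Finset.univ : Finset (Fin m)) fun i _ =>
    (tendsto_card_residueClass_Icc N (c i)).comp (tendsto_eval_atTop i)
  simpa using this

theorem boxRatio_setOf_mem {m : ℕ} {T : Type*} [DecidableEq T] (f : (Fin m → ℤ) → T)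
    (B : Finset T) (r : Fin m → ℝ) :
    boxRatio {x | f x ∈ B} r = ∑ t ∈ B, boxRatio {x | f x = t} r := by
  classical
  unfold boxRatio
  rw [← Finset.sum_div]
  congr 1
  rw [natCard_inter_box, ← Nat.cast_sum, Finset.card_eq_sum_card_fiberwise (f := f) (t := B)]
  · congr 1
    refine Finset.sum_congr rfl fun t ht => ?_
    rw [natCard_inter_box, Finset.filter_filter]
    congr 1
    refine Finset.filter_congr fun x _ => ?_
    simp only [Set.mem_ofPred_eq]
    exact ⟨fun h => h.2, fun h => ⟨h ▸ ht, h⟩⟩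
  · intro x hx
    simpa using (Finset.mem_filter.1 hx).2

/-- Finitely many congruence conditions to coprime moduli are independent. -/
theorem tendsto_boxRatio_of_coprime {m : ℕ} {ι : Type*} [Fintype ι] (a : ι → ℕ)
    [∀ p, NeZero (a p)] (ha : Pairwise (Function.onFun Nat.Coprime a))
    (B : (p : ι) → Set (Fin m → ZMod (a p))) :
    Tendsto (boxRatio {x : Fin m → ℤ | ∀ p, (fun i => (x i : ZMod (a p))) ∈ B p}) atTop
      (nhds (∏ p, (Nat.card ↥(B p) : ℝ) / (a p : ℝ) ^ m)) := by
  classical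
  set N := ∏ p, a p with hN
  have : NeZero N := ⟨Finset.prod_ne_zero_iff.2 fun p _ => NeZero.ne _⟩
  let e : ZMod N ≃+* Π p, ZMod (a p) := ZMod.prodEquivPi a ha
  let F : Finset (Π p, Fin m → ZMod (a p)) := Fintype.piFinset fun p => (B p).toFinset
  let f : (Fin m → ℤ) → Π p, Fin m → ZMod (a p) := fun x p i => (x i : ZMod (a p))
  have hset : {x : Fin m → ℤ | ∀ p, (fun i => (x i : ZMod (a p))) ∈ B p} = {x | f x ∈ F} := by
    ext x; simp [F, f]
  have hclass (t : Π p, Fin m → ZMod (a p)) : {x | f x = t} =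
      {x : Fin m → ℤ | ∀ i, (x i : ZMod N) = e.symm fun p => t p i} := by
    ext x
    simp only [Set.mem_ofPred_eq, RingEquiv.eq_symm_apply, map_intCast, f, funext_iff,
      Pi.intCast_apply]
    exact forall_comm
  have hlim : ∏ p, (Nat.card ↥(B p) : ℝ) / (a p : ℝ) ^ m = ∑ _t ∈ F, (1 / (N : ℝ)) ^ m := by
    rw [Finset.sum_const, nsmul_eq_mul, Fintype.card_piFinset, Finset.prod_div_distrib,
      Finset.prod_pow, hN]
    push_cast
    simp [div_eq_mul_inv, Set.toFinset_card]
  rw [hlim, hset, funext (boxRatio_setOf_mem f F)]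
  refine tendsto_finsetSum _ fun t _ => ?_
  rw [hclass]
  exact tendsto_boxRatio_residueClass N _

theorem card_div_pow_le_one {m N : ℕ} [NeZero N] (B : Set (Fin m → ZMod N)) :
    (Nat.card ↥B : ℝ) / (N : ℝ) ^ m ≤ 1 := by
  refine div_le_one_of_le₀ ?_ (by positivity)
  have h : Nat.card ↥B ≤ Nat.card (Fin m → ZMod N) := Finite.card_subtype_le _
  have h2 : Nat.card (Fin m → ZMod N) = N ^ m := by simp
  exact_mod_cast h2 ▸ h

/-- the sieve: for an admissible family of local conditions, the affine box
density of `S = ⋂_p S_p` exists and equals the product of the local densities `π(S_p)`. -/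
theorem stmt_4 (m : ℕ) (hm : 2 ≤ m) (n : ℕ → ℕ) (hn : ∀ p : ℕ, p.Prime → 1 ≤ n p)
    (Sbar : (p : ℕ) → Set (Fin m → ZMod (p ^ n p)))
    (hadm : Tendsto (fun Z : ℝ =>
        limsup (fun r : Fin m → ℝ =>
          (Nat.card ↥({x : Fin m → ℤ | ∃ p : ℕ, p.Prime ∧ Z < (p : ℝ) ∧
              (fun i => (x i : ZMod (p ^ n p))) ∉ Sbar p} ∩ box r) : ℝ) /
            (Nat.card ↥(box r) : ℝ)) atTop)
      atTop (nhds 0)) :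
    ∃ L : ℝ,
      Tendsto (fun Z : ℕ => ∏ p ∈ (Finset.range (Z + 1)).filter Nat.Prime,
          (Nat.card ↥(Sbar p) : ℝ) / (p : ℝ) ^ (m * n p)) atTop (nhds L) ∧
      Tendsto (fun r : Fin m → ℝ =>
          (Nat.card ↥({x : Fin m → ℤ | ∀ p : ℕ, p.Prime →
              (fun i => (x i : ZMod (p ^ n p))) ∈ Sbar p} ∩ box r) : ℝ) /
            (Nat.card ↥(box r) : ℝ)) atTop (nhds L) := by
  set P : ℕ → ℝ := fun Z => ∏ p ∈ (Finset.range (Z + 1)).filter Nat.Prime,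
    (Nat.card ↥(Sbar p) : ℝ) / (p : ℝ) ^ (m * n p) with hP
  have hP0 : ∀ Z, 0 ≤ P Z := fun Z => Finset.prod_nonneg fun p _ => by positivity
  have hPanti : Antitone P := by
    intro Y Z hYZ
    have hsub : (Finset.range (Y + 1)).filter Nat.Prime ⊆ (Finset.range (Z + 1)).filter Nat.Prime :=
      Finset.filter_subset_filter _ (Finset.range_mono (by omega))
    simp only [hP]
    rw [← Finset.prod_sdiff hsub]
    refine mul_le_of_le_one_left (hP0 Y) (Finset.prod_le_one (fun p _ => by positivity) ?_)
    intro p hp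
    replace hp := (Finset.mem_sdiff.1 hp).1
    have hp' : p.Prime := (Finset.mem_filter.1 hp).2
    have : NeZero (p ^ n p) := ⟨pow_ne_zero _ hp'.ne_zero⟩
    have := card_div_pow_le_one (Sbar p)
    rwa [Nat.cast_pow, ← pow_mul, mul_comm (n p)] at this
  have hPbdd : BddBelow (Set.range P) := ⟨0, by rintro _ ⟨Z, rfl⟩; exact hP0 Z⟩
  have hPL : Tendsto P atTop (nhds (⨅ Z, P Z)) := tendsto_atTop_ciInf hPanti hPbdd
  refine ⟨⨅ Z, P Z, hPL, ?_⟩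
  have hfin (Z : ℕ) : Tendsto (boxRatio {x : Fin m → ℤ | ∀ p : ℕ, p.Prime → p ≤ Z →
      (fun i => (x i : ZMod (p ^ n p))) ∈ Sbar p}) atTop (nhds (P Z)) := by
    let I := (Finset.range (Z + 1)).filter Nat.Prime
    have hI (p : I) : (p : ℕ).Prime := (Finset.mem_filter.1 p.2).2
    have (p : I) : NeZero ((p : ℕ) ^ n p) := ⟨pow_ne_zero _ (hI p).ne_zero⟩
    have h := tendsto_boxRatio_of_coprime (fun p : I => (p : ℕ) ^ n p)
      (fun p q hpq => Nat.Coprime.pow _ _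
        ((Nat.coprime_primes (hI p) (hI q)).2 fun h => hpq (Subtype.ext h)))
      (fun p => Sbar p)
    convert h using 2
    · ext x
      simp only [Set.mem_ofPred_eq, Subtype.forall, I, Finset.mem_filter, Finset.mem_range,
        Nat.lt_succ_iff]
      exact ⟨fun h p hp => h p hp.2 hp.1, fun h p hp hpZ => h p ⟨hpZ, hp⟩⟩
    · rw [hP]
      simp only
      rw [← Finset.prod_coe_sort]
      refine Finset.prod_congr rfl fun p _ => ?_
      rw [Nat.cast_pow, ← pow_mul, mul_comm (n p)]
  set S : Set (Fin m → ℤ) := {x | ∀ p : ℕ, p.Prime →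
    (fun i => (x i : ZMod (p ^ n p))) ∈ Sbar p} with hS
  change Tendsto (boxRatio S) atTop _
  refine Metric.tendsto_nhds.2 fun ε hε => ?_
  obtain ⟨Z, hZtail, hZP⟩ := ((tendsto_natCast_atTop_atTop.eventually
    (hadm.eventually (gt_mem_nhds (half_pos hε)))).and
      (hPL.eventually (gt_mem_nhds (lt_add_of_pos_right _ (half_pos hε))))).exists
  have htail := eventually_lt_of_limsup_lt hZtail
    ⟨1, eventually_map.2 (Eventually.of_forall fun r => boxRatio_le_one _ r)⟩
  filter_upwards [htail, Metric.tendsto_nhds.1 (hfin Z) (ε / 2) (half_pos hε)] with r h1 h2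
  change boxRatio _ r < _ at h1
  have hsub : S ⊆ {x : Fin m → ℤ | ∀ p : ℕ, p.Prime → p ≤ Z →
      (fun i => (x i : ZMod (p ^ n p))) ∈ Sbar p} := fun x hx p hp _ => hx p hp
  have hupper := boxRatio_mono hsub r
  have hlower := boxRatio_le_add (C := S) (A := {x : Fin m → ℤ | ∀ p : ℕ, p.Prime → p ≤ Z →
      (fun i => (x i : ZMod (p ^ n p))) ∈ Sbar p})
    (B := {x : Fin m → ℤ | ∃ p : ℕ, p.Prime ∧ (Z : ℝ) < (p : ℝ) ∧
      (fun i => (x i : ZMod (p ^ n p))) ∉ Sbar p}) (fun x hx => by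
      by_cases hxS : x ∈ S
      · exact Or.inr hxS
      · left
        simp only [hS, Set.mem_ofPred_eq, not_forall] at hxS
        obtain ⟨p, hp, hpx⟩ := hxS
        exact ⟨p, hp, by exact_mod_cast not_le.1 fun hle => hpx (hx p hp hle), hpx⟩) r
  have hLP : (⨅ Z, P Z) ≤ P Z := ciInf_le hPbdd Z
  rw [Real.dist_eq, abs_lt] at h2 ⊢
  constructor <;> linarith [h2.1, h2.2]
end
end

section
/- Fix an integer d ≥ 2. There exists a constant C > 0 depending only on d such that for every prime p and every variable v among x_0,…,x_d,y_0,…,y_d, the number of points Q ∈ 𝔽_p^{2d+2} satisfying 𝔯(Q) = 0 and (∂𝔯/∂v)(Q) = 0 is at most C·p^{2d}. -/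
open Filter MvPolynomial

noncomputable section

/-- The coefficient vector of the pair `(F, G)`, both truncated at degree `d`. -/
def pairPt (d : ℕ) {R : Type*} [CommRing R] (F G : Polynomial R) : Fin (2 * d + 2) → R :=
  fun k => if (k : ℕ) ≤ d then F.coeff k else G.coeff ((k : ℕ) - (d + 1))

lemma exists_eq_pairPt (d : ℕ) {R : Type*} [CommRing R] (Q : Fin (2 * d + 2) → R) :
    ∃ F G : Polynomial R, F.natDegree ≤ d ∧ G.natDegree ≤ d ∧ Q = pairPt d F G := by
  classical
  refine ⟨Polynomial.ofFn (d + 1) fun i => Q ⟨i, by omega⟩,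
    Polynomial.ofFn (d + 1) fun i => Q ⟨d + 1 + i, by omega⟩,
    Nat.lt_succ_iff.mp (Polynomial.ofFn_natDegree_lt (by omega) _),
    Nat.lt_succ_iff.mp (Polynomial.ofFn_natDegree_lt (by omega) _), ?_⟩
  funext k
  unfold pairPt
  split_ifs with h
  · rw [Polynomial.ofFn_coeff_eq_val_of_lt _ (by omega)]
  · rw [Polynomial.ofFn_coeff_eq_val_of_lt _ (by omega)]
    congr 1
    ext
    simp
    omega

lemma map_sylvesterMat (d : ℕ) {R S : Type*} [CommRing R] [CommRing S] (φ : R →+* S)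
    (Q : Fin (2 * d + 2) → R) :
    φ.mapMatrix (sylvesterMat d Q) = sylvesterMat d fun i => φ (Q i) := by
  ext i j
  simp only [sylvesterMat, RingHom.mapMatrix_apply, Matrix.map_apply, Matrix.of_apply]
  split_ifs <;> simp

lemma map_resEval (d : ℕ) {R S : Type*} [CommRing R] [CommRing S] (φ : R →+* S)
    (Q : Fin (2 * d + 2) → R) : φ (resEval d Q) = resEval d fun i => φ (Q i) := by
  rw [resEval_eq_det, resEval_eq_det, RingHom.map_det, map_sylvesterMat]

lemma resEval_pairPt (d : ℕ) {R : Type*} [CommRing R] (F G : Polynomial R) :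
    resEval d (pairPt d F G) = Polynomial.resultant G F d d := by
  rw [resEval_eq_det, Polynomial.resultant, ← Matrix.det_transpose,
    ← Matrix.det_reindex_self (finCongr (two_mul d))]
  congr 1
  ext i j
  induction j using Fin.addCases with
  | left j =>
    simp only [sylvesterMat, Polynomial.sylvester, pairPt, Matrix.reindex_apply,
      Matrix.submatrix_apply, Matrix.transpose_apply, Matrix.of_apply, finCongr_symm,
      finCongr_apply, Fin.val_cast, Fin.val_castAdd, Fin.addCases_left, Set.mem_Icc]
    grind
  | right j =>
    simp only [sylvesterMat, Polynomial.sylvester, pairPt, Matrix.reindex_apply,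
      Matrix.submatrix_apply, Matrix.transpose_apply, Matrix.of_apply, finCongr_symm,
      finCongr_apply, Fin.val_cast, Fin.val_natAdd, Fin.addCases_right, Set.mem_Icc]
    grind

/-- Exchanging the coefficients of the two forms. -/
def swapForms (d : ℕ) : Fin (2 * d + 2) ≃ Fin (2 * d + 2) where
  toFun k := if h : (k : ℕ) ≤ d then ⟨k + (d + 1), by omega⟩ else ⟨k - (d + 1), by omega⟩
  invFun k := if h : (k : ℕ) ≤ d then ⟨k + (d + 1), by omega⟩ else ⟨k - (d + 1), by omega⟩
  left_inv k := by grind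
  right_inv k := by grind

lemma pairPt_comp_swapForms (d : ℕ) {R : Type*} [CommRing R] (F G : Polynomial R) :
    pairPt d F G ∘ swapForms d = pairPt d G F := by
  funext k
  simp only [pairPt, swapForms, Function.comp, Equiv.coe_fn_mk]
  split_ifs <;> simp_all <;> omega

lemma resEval_comp_swapForms (d : ℕ) {R : Type*} [CommRing R] (Q : Fin (2 * d + 2) → R) :
    resEval d (Q ∘ swapForms d) = (-1) ^ (d * d) * resEval d Q := by
  obtain ⟨F, G, -, -, rfl⟩ := exists_eq_pairPt d Q
  rw [pairPt_comp_swapForms, resEval_pairPt, resEval_pairPt, Polynomial.resultant_comm]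

/-- The resultant as a univariate polynomial in the variable `v`, the other variables being
specialised to the coordinates of `Q`. -/
def slice (d : ℕ) {R : Type*} [CommRing R] (Q : Fin (2 * d + 2) → R) (v : Fin (2 * d + 2)) :
    Polynomial R :=
  resEval d (Function.update (fun i => Polynomial.C (Q i)) v Polynomial.X)

lemma eval_slice (d : ℕ) {R : Type*} [CommRing R] (Q : Fin (2 * d + 2) → R)
    (v : Fin (2 * d + 2)) (t : R) :
    (slice d Q v).eval t = resEval d (Function.update Q v t) := by
  rw [slice, ← Polynomial.coe_evalRingHom, map_resEval]
  congr 1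
  funext i
  by_cases h : i = v
  · subst h; simp
  · simp [h]

lemma slice_update (d : ℕ) {R : Type*} [CommRing R] (Q : Fin (2 * d + 2) → R)
    (v : Fin (2 * d + 2)) (t : R) : slice d (Function.update Q v t) v = slice d Q v := by
  unfold slice
  congr 1
  funext i
  by_cases h : i = v
  · subst h; simp
  · simp [h]

lemma map_slice (d : ℕ) {R S : Type*} [CommRing R] [CommRing S] (φ : R →+* S)
    (Q : Fin (2 * d + 2) → R) (v : Fin (2 * d + 2)) :
    (slice d Q v).map φ = slice d (fun i => φ (Q i)) v := by
  rw [slice, ← Polynomial.coe_mapRingHom, map_resEval, slice]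
  congr 1
  funext i
  by_cases h : i = v
  · subst h; simp
  · simp [h]

lemma eval_derivative_aeval_update {σ R : Type*} [DecidableEq σ] [CommRing R] (Q : σ → R) (v : σ)
    (P : MvPolynomial σ ℤ) :
    (aeval (Function.update (fun i => Polynomial.C (Q i)) v Polynomial.X) P).derivative.eval (Q v)
      = aeval Q (pderiv v P) := by
  have key : ∀ P : MvPolynomial σ ℤ,
      (aeval (Function.update (fun i => Polynomial.C (Q i)) v Polynomial.X) P).eval (Q v)
        = aeval Q P := by
    intro P
    induction P using MvPolynomial.induction_on with
    | C a => simp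
    | add p q hp hq => simp [hp, hq]
    | mul_X p i hp =>
      by_cases h : i = v
      · subst h; simp [hp]
      · simp [hp, h]
  induction P using MvPolynomial.induction_on with
  | C a => simp
  | add p q hp hq => simp [hp, hq]
  | mul_X p i hp =>
    by_cases h : i = v
    · subst h; simp [hp, key, Derivation.leibniz, mul_comm]
    · simp [hp, h, Derivation.leibniz, mul_comm]

lemma eval_derivative_slice (d : ℕ) {R : Type*} [CommRing R] (Q : Fin (2 * d + 2) → R)
    (v : Fin (2 * d + 2)) :
    (slice d Q v).derivative.eval (Q v) = aeval Q (pderiv v (resPoly d)) :=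
  eval_derivative_aeval_update Q v _

lemma slice_comp_swapForms (d : ℕ) {R : Type*} [CommRing R] (Q : Fin (2 * d + 2) → R)
    (v : Fin (2 * d + 2)) :
    slice d (Q ∘ swapForms d) v = (-1) ^ (d * d) * slice d Q (swapForms d v) := by
  unfold slice
  rw [← resEval_comp_swapForms, Function.update_comp_equiv]
  simp [Function.comp_def]

lemma natDegree_prod_le_and_coeff_prod {ι R : Type*} [CommRing R] (s : Finset ι)
    (f : ι → Polynomial R) (n : ι → ℕ) (h : ∀ i ∈ s, (f i).natDegree ≤ n i) :
    (∏ i ∈ s, f i).natDegree ≤ ∑ i ∈ s, n i ∧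
      (∏ i ∈ s, f i).coeff (∑ i ∈ s, n i) = ∏ i ∈ s, (f i).coeff (n i) := by
  classical
  induction s using Finset.induction_on with
  | empty => simp
  | insert a s ha ih =>
    obtain ⟨h1, h2⟩ := ih fun i hi => h i (Finset.mem_insert_of_mem hi)
    have h3 := h a (Finset.mem_insert_self a s)
    simp only [Finset.prod_insert ha, Finset.sum_insert ha]
    exact ⟨Polynomial.natDegree_mul_le_of_le h3 h1,
      by rw [Polynomial.coeff_mul_add_eq_of_natDegree_le h3 h1, h2]⟩

lemma natDegree_det_le_and_coeff_det {ι R : Type*} [CommRing R] [Fintype ι] [DecidableEq ι]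
    (M : Matrix ι ι (Polynomial R)) (n : ι → ℕ) (h : ∀ i j, (M i j).natDegree ≤ n i) :
    M.det.natDegree ≤ ∑ i, n i ∧
      M.det.coeff (∑ i, n i) = (Matrix.of fun i j => (M i j).coeff (n i)).det := by
  have key (τ : Equiv.Perm ι) := natDegree_prod_le_and_coeff_prod Finset.univ
    (fun i => M i (τ i)) n fun i _ => h i _
  rw [← Matrix.det_transpose M, ← Matrix.det_transpose (Matrix.of _), Matrix.det_apply,
    Matrix.det_apply]
  refine ⟨Polynomial.natDegree_sum_le_of_forall_le _ _ fun τ _ =>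
    (Polynomial.natDegree_smul_le _ _).trans (key τ).1, ?_⟩
  rw [Polynomial.finsetSum_coeff]
  refine Finset.sum_congr rfl fun τ _ => ?_
  rw [Polynomial.coeff_smul]
  congr 1
  exact (key τ).2

lemma update_pairPt (d : ℕ) {R : Type*} [CommRing R] (F F' G : Polynomial R)
    (v : Fin (2 * d + 2)) (hv : (v : ℕ) ≤ d) (t : R)
    (hF : ∀ k ≠ (v : ℕ), F'.coeff k = F.coeff k) (hF' : F'.coeff v = t) :
    Function.update (pairPt d F G) v t = pairPt d F' G := by
  funext k
  by_cases h : k = v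
  · subst h; simp [pairPt, hv, hF']
  · have h' : (k : ℕ) ≠ v := fun e => h (Fin.ext e)
    simp [pairPt, h, hF _ h']

lemma slice_pairPt (d : ℕ) {R : Type*} [CommRing R] (F G : Polynomial R)
    (F' : Polynomial (Polynomial R)) (v : Fin (2 * d + 2)) (hv : (v : ℕ) ≤ d)
    (hF : ∀ k ≠ (v : ℕ), F'.coeff k = Polynomial.C (F.coeff k))
    (hF' : F'.coeff v = Polynomial.X) :
    slice d (pairPt d F G) v = Polynomial.resultant (G.map Polynomial.C) F' d d := by
  have h : (fun i => Polynomial.C (pairPt d F G i)) =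
      pairPt d (F.map Polynomial.C) (G.map Polynomial.C) := by
    funext k
    unfold pairPt
    split_ifs <;> simp
  rw [slice, h, update_pairPt d _ F' _ v hv _ (by simpa using hF) hF', resEval_pairPt]

lemma natDegree_slice_le_and_coeff (d : ℕ) {R : Type*} [CommRing R] (F G : Polynomial R)
    (v : Fin (2 * d + 2)) (hv : (v : ℕ) ≤ d) :
    (slice d (pairPt d F G) v).natDegree ≤ d ∧
      (slice d (pairPt d F G) v).coeff d =
        Polynomial.resultant G (Polynomial.X ^ (v : ℕ)) d d := by
  have hsum : ∑ i : Fin (2 * d), (if (i : ℕ) < d then 1 else 0) = d := by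
    rw [Fin.sum_univ_eq_sum_range (fun i => if i < d then 1 else 0) (2 * d), two_mul,
      Finset.sum_range_add]
    simp [Finset.filter_true_of_mem]
  have key := natDegree_det_le_and_coeff_det
    (sylvesterMat d (Function.update (fun i => Polynomial.C (pairPt d F G i)) v Polynomial.X))
    (fun i => if (i : ℕ) < d then 1 else 0) (by
      intro i j
      simp only [sylvesterMat, Matrix.of_apply, Function.update_apply, Fin.ext_iff]
      split_ifs <;> first
        | exact Polynomial.natDegree_X_le | omega | simp)
  rw [hsum, ← resEval_eq_det] at key
  refine ⟨key.1, key.2.trans ?_⟩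
  rw [← resEval_pairPt, resEval_eq_det]
  congr 1
  ext i j
  simp only [sylvesterMat, Matrix.of_apply, Function.update_apply, Fin.ext_iff, pairPt]
  split_ifs <;> simp_all [Polynomial.coeff_C, Polynomial.coeff_X_pow] <;> omega

lemma resultant_X_pow_right_eq_zero {K : Type*} [Field K] (d i : ℕ) (hi : i ≤ d)
    (G : Polynomial K) (hG : G.natDegree ≤ d)
    (h : Polynomial.resultant G (Polynomial.X ^ i) d d = 0) :
    (G.coeff 0 = 0 ∧ i ≠ 0) ∨ (G.coeff d = 0 ∧ i ≠ d) := by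
  obtain ⟨k, rfl⟩ := Nat.exists_eq_add_of_le hi
  rw [Polynomial.resultant_add_right_deg _ _ _ _ _ (Polynomial.natDegree_X_pow_le i),
    Polynomial.resultant_X_pow_right _ _ _ hG] at h
  simp only [mul_eq_zero, pow_eq_zero_iff', neg_eq_zero, one_ne_zero, false_and, false_or] at h
  rcases h with h | h
  · exact Or.inr ⟨h.1, by omega⟩
  · exact Or.inl h

lemma natDegree_X_pow_sub_one_le {R : Type*} [CommRing R] (d : ℕ) :
    (Polynomial.X ^ d - 1 : Polynomial R).natDegree ≤ d :=
  (Polynomial.natDegree_sub_le_of_le (Polynomial.natDegree_X_pow_le d)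
    (Polynomial.natDegree_one.le.trans (Nat.zero_le d))).trans_eq (max_self d)

lemma resultant_X_pow_sub_one_X_add_C {R : Type*} [CommRing R] (d n : ℕ) (hd : d ≠ 0) (hn : 1 ≤ n)
    (t : R) : Polynomial.resultant (Polynomial.X ^ d - 1) (Polynomial.X + Polynomial.C t) d n =
      (-1) ^ d * ((-t) ^ d - 1) := by
  obtain ⟨m, rfl⟩ := Nat.exists_eq_add_of_le hn
  have hG : (Polynomial.X ^ d - 1 : Polynomial R).natDegree ≤ d :=
    natDegree_X_pow_sub_one_le d
  rw [Polynomial.resultant_add_right_deg _ _ _ _ _ (Polynomial.natDegree_add_C.trans_le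
      Polynomial.natDegree_X_le),
    Polynomial.resultant_X_add_C_right _ _ _ hG]
  simp [Polynomial.coeff_one, hd]

lemma exists_slice_eq (d : ℕ) (hd : 2 ≤ d) (v : Fin (2 * d + 2)) (hv : (v : ℕ) ≤ d) :
    ∃ (Q : Fin (2 * d + 2) → ℤ) (k : ℕ),
      slice d Q v = (-1) ^ k * ((-Polynomial.X) ^ d - 1) := by
  have hG : (Polynomial.X ^ d - 1 : Polynomial (Polynomial ℤ)).natDegree ≤ d :=
    natDegree_X_pow_sub_one_le d
  have hm : (Polynomial.X ^ d - 1 : Polynomial ℤ).map Polynomial.C = Polynomial.X ^ d - 1 := by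
    simp
  rcases hv.lt_or_eq with h | h
  · obtain ⟨m, hm'⟩ := Nat.exists_eq_add_of_lt h
    refine ⟨pairPt d (Polynomial.X ^ ((v : ℕ) + 1)) (Polynomial.X ^ d - 1),
      d * v + v + d, ?_⟩
    rw [slice_pairPt d _ _
      (Polynomial.X ^ (v : ℕ) * (Polynomial.X + Polynomial.C Polynomial.X)) v hv, hm]
    · have hr := Polynomial.resultant_mul_right (Polynomial.X ^ d - 1)
        (Polynomial.X ^ (v : ℕ)) (Polynomial.X + Polynomial.C (Polynomial.X : Polynomial ℤ)) d hG
      rw [Polynomial.natDegree_X_pow, Polynomial.natDegree_X_add_C,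
        resultant_X_pow_sub_one_X_add_C _ _ (by omega) le_rfl,
        Polynomial.resultant_X_pow_right _ _ _ hG] at hr
      have hdeg : (Polynomial.X ^ (v : ℕ) *
          (Polynomial.X + Polynomial.C (Polynomial.X : Polynomial ℤ))).natDegree ≤ (v : ℕ) + 1 :=
        Polynomial.natDegree_mul_le_of_le (Polynomial.natDegree_X_pow_le _)
          (Polynomial.natDegree_X_add_C _).le
      have hr' := Polynomial.resultant_add_right_deg (Polynomial.X ^ d - 1) _ d _ m hdeg
      rw [hr, show (v : ℕ) + 1 + m = d by omega] at hr'
      rw [hr']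
      have hd0 : d ≠ 0 := by omega
      simp [Polynomial.coeff_one, hd0, hd0.symm]
      ring
    · intro k hk
      rw [mul_add, ← pow_succ, Polynomial.coeff_add, Polynomial.coeff_mul_C]
      simp [Polynomial.coeff_X_pow, hk]
    · rw [mul_add, ← pow_succ, Polynomial.coeff_add, Polynomial.coeff_mul_C]
      simp [Polynomial.coeff_X_pow]
  · refine ⟨pairPt d Polynomial.X (Polynomial.X ^ d - 1), d, ?_⟩
    rw [slice_pairPt d _ _ (Polynomial.X + Polynomial.C Polynomial.X +
      (Polynomial.X ^ d - 1) * Polynomial.C Polynomial.X) v hv, hm,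
      Polynomial.resultant_add_mul_right _ _ _ _ _ (by simp) hG,
      resultant_X_pow_sub_one_X_add_C _ _ (by omega) (by omega)]
    · intro k hk
      rw [sub_mul, one_mul, ← add_sub_assoc, add_right_comm, add_sub_cancel_right,
        Polynomial.coeff_add, Polynomial.coeff_mul_C]
      simp [Polynomial.coeff_X_pow, Polynomial.coeff_X, h ▸ hk]
    · rw [sub_mul, one_mul, ← add_sub_assoc, add_right_comm, add_sub_cancel_right,
        Polynomial.coeff_add, Polynomial.coeff_mul_C]
      simp [Polynomial.coeff_X_pow, Polynomial.coeff_X, h]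
      omega

lemma resultant_derivative_ne_zero (d k : ℕ) (hd : d ≠ 0) :
    Polynomial.resultant ((-1) ^ k * ((-Polynomial.X) ^ d - 1) : Polynomial ℤ)
      (Polynomial.derivative ((-1) ^ k * ((-Polynomial.X) ^ d - 1))) d (d - 1) ≠ 0 := by
  intro h
  have h2 := congrArg (Int.castRingHom ℚ) h
  rw [← Polynomial.resultant_map_map, ← Polynomial.derivative_map, map_zero] at h2
  set f : Polynomial ℚ :=
    ((-1) ^ k * ((-Polynomial.X) ^ d - 1) : Polynomial ℤ).map (Int.castRingHom ℚ) with hf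
  have hf' : f = Polynomial.C ((-1) ^ (k + d)) * (Polynomial.X ^ d - Polynomial.C ((-1) ^ d)) := by
    rw [hf]
    simp only [Polynomial.map_mul, Polynomial.map_sub, Polynomial.map_pow, Polynomial.map_neg,
      Polynomial.map_one, Polynomial.map_X, map_pow, map_neg, map_one, neg_pow (Polynomial.X : Polynomial ℚ) d]
    have : ((-1 : Polynomial ℚ) ^ d) * (-1) ^ d = 1 := by rw [← mul_pow]; simp
    linear_combination (-1 : Polynomial ℚ) ^ k * this
  have hu : ((-1 : ℚ) ^ (k + d)) ≠ 0 := by simp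
  have hdeg : f.natDegree = d := by
    rw [hf', Polynomial.natDegree_C_mul hu, Polynomial.natDegree_X_pow_sub_C]
  have hsep : f.Separable := by
    rw [hf']
    exact Polynomial.Separable.unit_mul (Polynomial.isUnit_C.mpr hu.isUnit)
      (Polynomial.separable_X_pow_sub_C _ (by exact_mod_cast hd) (by simp))
  have h3 := Polynomial.resultant_ne_zero f f.derivative hsep
  rw [Polynomial.natDegree_derivative, hdeg] at h3
  exact h3 h2

/-- Double counting along the lines in direction `v`. -/
lemma card_mul_card_le_of_fiber {σ K : Type*} [Fintype σ] [DecidableEq σ] [Fintype K] [DecidableEq K]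
    (Z S : Finset (σ → K)) (v : σ) (b : ℕ) (hZS : Z ⊆ S)
    (hS : ∀ Q ∈ S, ∀ t, Function.update Q v t ∈ S)
    (hb : ∀ Q ∈ S, (Finset.univ.filter fun t => Function.update Q v t ∈ Z).card ≤ b) :
    Z.card * Fintype.card K ≤ b * S.card := by
  have h1 : (Z ×ˢ (Finset.univ : Finset K)).card ≤
      (S.sigma fun Q => Finset.univ.filter fun t => Function.update Q v t ∈ Z).card := by
    refine Finset.card_le_card_of_injOn
      (fun x => (⟨Function.update x.1 v x.2, x.1 v⟩ : Σ _ : σ → K, K)) ?_ ?_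
    · rintro ⟨R, s⟩ h
      simp only [Finset.coe_product, Set.mem_prod, Finset.mem_coe, Finset.mem_univ,
        and_true] at h
      simp only [Finset.mem_coe, Finset.mem_sigma, Finset.mem_filter, Finset.mem_univ, true_and,
        Function.update_idem, Function.update_eq_self]
      exact ⟨hS _ (hZS h) _, h⟩
    · rintro ⟨R, s⟩ - ⟨R', s'⟩ - h
      simp only [Sigma.mk.injEq, heq_eq_eq] at h
      obtain ⟨h, h'⟩ := h
      have hs := congrFun h v
      simp only [Function.update_self] at hs
      have hR := congrArg (fun f => Function.update f v (R v)) h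
      simp only [Function.update_idem, Function.update_eq_self] at hR
      rw [h', Function.update_eq_self] at hR
      rw [hR, hs]
  rw [Finset.card_product, Finset.card_univ, Finset.card_sigma] at h1
  refine h1.trans ((Finset.sum_le_sum hb).trans ?_)
  simp [mul_comm]

lemma card_zeros_mul_le {n p : ℕ} [Fact p.Prime] (D : MvPolynomial (Fin n) ℤ)
    (hD : ∃ Q : Fin n → ZMod p, aeval Q D ≠ 0) :
    (Finset.univ.filter fun Q : Fin n → ZMod p => aeval Q D = 0).card * p ≤
      D.totalDegree * p ^ n := by
  have hp : 0 < p := (Fact.out : p.Prime).pos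
  set D' := MvPolynomial.map (Int.castRingHom (ZMod p)) D with hD'
  have he (Q : Fin n → ZMod p) : eval Q D' = aeval Q D := by
    rw [hD', eval_map, aeval_def]
    rfl
  have hne : D' ≠ 0 := by
    rintro h
    obtain ⟨Q, hQ⟩ := hD
    exact hQ (by rw [← he, h, map_zero])
  have h := schwartz_zippel_totalDegree hne Finset.univ
  simp only [Fintype.piFinset_univ, Finset.card_univ, ZMod.card, he] at h
  rw [div_le_div_iff₀ (by positivity) (by positivity)] at h
  have h' : (Finset.univ.filter fun Q : Fin n → ZMod p => aeval Q D = 0).card * p ≤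
      D'.totalDegree * p ^ n := by exact_mod_cast h
  refine h'.trans (Nat.mul_le_mul_right _ ?_)
  exact Finset.sup_mono (support_map_subset _ _)

lemma card_mul_sq_le {n p : ℕ} [Fact p.Prime] (D : MvPolynomial (Fin n) ℤ)
    (hD : ∃ Q : Fin n → ZMod p, aeval Q D ≠ 0) (v : Fin n) (b : ℕ)
    (hv : ∀ (Q : Fin n → ZMod p) t, aeval (Function.update Q v t) D = aeval Q D)
    (Z : Finset (Fin n → ZMod p)) (hZ : ∀ Q ∈ Z, aeval Q D = 0)
    (hb : ∀ Q, (Finset.univ.filter fun t => Function.update Q v t ∈ Z).card ≤ b) :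
    Z.card * p ^ 2 ≤ D.totalDegree * b * p ^ n := by
  have h1 := card_mul_card_le_of_fiber Z
    (Finset.univ.filter fun Q : Fin n → ZMod p => aeval Q D = 0) v b
    (fun Q hQ => by simpa using hZ Q hQ)
    (fun Q hQ t => by simpa [hv] using hQ) (fun Q _ => hb Q)
  rw [ZMod.card] at h1
  have h2 := card_zeros_mul_le D hD
  calc Z.card * p ^ 2 = Z.card * p * p := by ring
    _ ≤ b * _ * p := Nat.mul_le_mul_right _ h1
    _ = b * (_ * p) := by ring
    _ ≤ b * (D.totalDegree * p ^ n) := Nat.mul_le_mul_left _ h2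
    _ = D.totalDegree * b * p ^ n := by ring

/-- The resultant with respect to `v` of the generic resultant and its derivative. -/
def sliceDiscr (d : ℕ) (v : Fin (2 * d + 2)) : MvPolynomial (Fin (2 * d + 2)) ℤ :=
  Polynomial.resultant (slice d (fun i => X i) v) (slice d (fun i => X i) v).derivative d (d - 1)

lemma aeval_sliceDiscr (d : ℕ) {R : Type*} [CommRing R] (Q : Fin (2 * d + 2) → R)
    (v : Fin (2 * d + 2)) : aeval Q (sliceDiscr d v) =
      Polynomial.resultant (slice d Q v) (slice d Q v).derivative d (d - 1) := by
  have h := map_slice d (aeval Q : MvPolynomial (Fin (2 * d + 2)) ℤ →ₐ[ℤ] R).toRingHom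
    (fun i => X i) v
  have hQ : (fun i => (aeval Q : MvPolynomial (Fin (2 * d + 2)) ℤ →ₐ[ℤ] R).toRingHom (X i)) = Q :=
    funext fun i => aeval_X Q i
  change (aeval Q : MvPolynomial (Fin (2 * d + 2)) ℤ →ₐ[ℤ] R).toRingHom _ = _
  rw [sliceDiscr, ← Polynomial.resultant_map_map, ← Polynomial.derivative_map, h, hQ]

/-- The generic resultant with the variables `v` and `w` set to zero. -/
def resZero (d : ℕ) (v w : Fin (2 * d + 2)) : MvPolynomial (Fin (2 * d + 2)) ℤ :=
  resEval d fun i => if i = v ∨ i = w then 0 else X i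

lemma aeval_resZero (d : ℕ) {R : Type*} [CommRing R] (Q : Fin (2 * d + 2) → R)
    (v w : Fin (2 * d + 2)) :
    aeval Q (resZero d v w) = resEval d fun i => if i = v ∨ i = w then 0 else Q i := by
  have h := map_resEval d (aeval Q : MvPolynomial (Fin (2 * d + 2)) ℤ →ₐ[ℤ] R).toRingHom
    fun i => if i = v ∨ i = w then 0 else X i
  refine Eq.trans h ?_
  congr 1
  funext i
  split_ifs <;> simp

lemma card_hyperplane_le (d : ℕ) {p : ℕ} [Fact p.Prime] (v w : Fin (2 * d + 2))
    (hne : ∃ Q : Fin (2 * d + 2) → ZMod p, Q v = 0 ∧ Q w = 0 ∧ resEval d Q ≠ 0) :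
    (Finset.univ.filter fun Q : Fin (2 * d + 2) → ZMod p =>
      Q w = 0 ∧ aeval Q (resZero d v w) = 0).card * p ^ 2 ≤
      (resZero d v w).totalDegree * p ^ (2 * d + 2) := by
  have h := card_mul_sq_le (p := p) (resZero d v w) ?_ w 1 ?_
    (Finset.univ.filter fun Q => Q w = 0 ∧ aeval Q (resZero d v w) = 0) ?_ ?_
  · simpa using h
  · obtain ⟨Q, h1, h2, h3⟩ := hne
    refine ⟨Q, ?_⟩
    rw [aeval_resZero]
    convert h3 using 2
    funext i
    split_ifs with h
    · rcases h with rfl | rfl <;> simp [h1, h2]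
    · rfl
  · intro Q t
    rw [aeval_resZero, aeval_resZero]
    congr 1
    funext i
    by_cases h : i = w <;> simp [h]
  · intro Q hQ
    exact (Finset.mem_filter.mp hQ).2.2
  · intro Q
    refine Finset.card_le_one.mpr fun s hs t ht => ?_
    simp only [Finset.mem_filter, Finset.mem_univ, true_and, Function.update_self] at hs ht
    rw [hs.1, ht.1]

lemma eq_zero_or_eq_zero_of_slice_eq_zero (d : ℕ) {K : Type*} [Field K]
    (Q : Fin (2 * d + 2) → K) (v : Fin (2 * d + 2)) (hv : (v : ℕ) ≤ d) (h : slice d Q v = 0) :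
    (Q ⟨d + 1, by omega⟩ = 0 ∧ (v : ℕ) ≠ 0) ∨ (Q ⟨2 * d + 1, by omega⟩ = 0 ∧ (v : ℕ) ≠ d) := by
  obtain ⟨F, G, -, hG, rfl⟩ := exists_eq_pairPt d Q
  have h1 := (natDegree_slice_le_and_coeff d F G v hv).2
  rw [h, Polynomial.coeff_zero] at h1
  have h2 := resultant_X_pow_right_eq_zero d v hv G hG h1.symm
  have h3 : ¬ (2 * d + 1 ≤ d) := by omega
  have h4 : 2 * d + 1 - (d + 1) = d := by omega
  simpa [pairPt, h3, h4] using h2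

lemma aeval_resZero_eq_zero (d : ℕ) {R : Type*} [CommRing R] (Q : Fin (2 * d + 2) → R)
    (v w : Fin (2 * d + 2)) (h : slice d Q v = 0) (hw : Q w = 0) :
    aeval Q (resZero d v w) = 0 := by
  have h1 := eval_slice d Q v 0
  rw [h, Polynomial.eval_zero] at h1
  rw [aeval_resZero]
  refine Eq.trans ?_ h1.symm
  congr 1
  funext i
  by_cases hi : i = v
  · simp [hi]
  · by_cases hiw : i = w
    · simp [hiw, hw, Function.update_apply]
    · simp [hi, hiw]

open Classical in
lemma card_slice_ne_zero_le (d : ℕ) (hd : 1 ≤ d) {p : ℕ} [Fact p.Prime] (v : Fin (2 * d + 2))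
    (hv : (v : ℕ) ≤ d) (hne : ∃ Q : Fin (2 * d + 2) → ZMod p, aeval Q (sliceDiscr d v) ≠ 0) :
    (Finset.univ.filter fun Q : Fin (2 * d + 2) → ZMod p =>
      slice d Q v ≠ 0 ∧ (slice d Q v).eval (Q v) = 0 ∧
        (slice d Q v).derivative.eval (Q v) = 0).card * p ^ 2 ≤
      (sliceDiscr d v).totalDegree * d * p ^ (2 * d + 2) := by
  have hdeg (Q : Fin (2 * d + 2) → ZMod p) : (slice d Q v).natDegree ≤ d := by
    obtain ⟨F, G, -, -, rfl⟩ := exists_eq_pairPt d Q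
    exact (natDegree_slice_le_and_coeff d F G v hv).1
  refine card_mul_sq_le (p := p) (sliceDiscr d v) hne v d ?_ _ ?_ ?_
  · intro Q t
    rw [aeval_sliceDiscr, aeval_sliceDiscr, slice_update]
  · intro Q hQ
    obtain ⟨-, -, h1, h2⟩ := Finset.mem_filter.mp hQ
    obtain ⟨a, b, -, -, h⟩ := Polynomial.exists_mul_add_mul_eq_C_resultant (slice d Q v)
      (slice d Q v).derivative (hdeg Q)
      ((Polynomial.natDegree_derivative_le _).trans (Nat.sub_le_sub_right (hdeg Q) 1))
      (Or.inl (by omega))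
    have h3 := congrArg (Polynomial.eval (Q v)) h
    rw [aeval_sliceDiscr]
    simpa [h1, h2] using h3.symm
  · intro Q
    by_cases h0 : slice d Q v = 0
    · simp [slice_update, h0]
    · refine (Finset.card_le_card (t := (slice d Q v).roots.toFinset) fun t ht => ?_).trans
        ((Multiset.toFinset_card_le _).trans ((Polynomial.card_roots' _).trans (hdeg Q)))
      simp only [Finset.mem_filter, Finset.mem_univ, true_and, slice_update,
        Function.update_self] at ht
      simpa [h0] using ht.2.1

open Classical in
lemma exists_card_mul_sq_le_of_le (d : ℕ) (hd : 2 ≤ d) (v : Fin (2 * d + 2)) (hv : (v : ℕ) ≤ d) :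
    ∃ c : ℕ, ∀ p : ℕ, [Fact p.Prime] →
      (Finset.univ.filter fun Q : Fin (2 * d + 2) → ZMod p =>
        (slice d Q v).eval (Q v) = 0 ∧ (slice d Q v).derivative.eval (Q v) = 0).card * p ^ 2 ≤
      c * p ^ (2 * d + 2) := by
  obtain ⟨Q₀, k, hQ₀⟩ := exists_slice_eq d hd v hv
  set N : ℤ := aeval Q₀ (sliceDiscr d v) with hN
  have hN0 : N ≠ 0 := by
    rw [hN, aeval_sliceDiscr, hQ₀]
    exact resultant_derivative_ne_zero d k (by omega)
  set w₀ : Fin (2 * d + 2) := ⟨d + 1, by omega⟩ with hw₀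
  set w₁ : Fin (2 * d + 2) := ⟨2 * d + 1, by omega⟩ with hw₁
  refine ⟨(sliceDiscr d v).totalDegree * d + (resZero d v w₀).totalDegree +
    (resZero d v w₁).totalDegree + N.natAbs ^ 2, fun p _ => ?_⟩
  have hp : p.Prime := Fact.out
  rcases le_or_gt p N.natAbs with hpN | hpN
  · rw [mul_comm]
    refine Nat.mul_le_mul ((Nat.pow_le_pow_left hpN 2).trans (Nat.le_add_left _ _)) ?_
    refine (Finset.card_le_univ _).trans ?_
    simp [ZMod.card]
  have h1 := card_slice_ne_zero_le d (by omega) (p := p) v hv ⟨fun i => (Q₀ i : ZMod p), by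
    have e : aeval (fun i => (Q₀ i : ZMod p)) (sliceDiscr d v) = (N : ZMod p) := by
      have := map_slice d (Int.castRingHom (ZMod p)) Q₀ v
      simp only [eq_intCast] at this
      rw [aeval_sliceDiscr, ← this, Polynomial.derivative_map, Polynomial.resultant_map_map, hN,
        aeval_sliceDiscr, eq_intCast]
    rw [e, Ne, ZMod.intCast_zmod_eq_zero_iff_dvd, Int.natCast_dvd]
    exact Nat.not_dvd_of_pos_of_lt (Int.natAbs_pos.mpr hN0) hpN⟩
  have h2 : (Finset.univ.filter fun Q : Fin (2 * d + 2) → ZMod p =>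
      (v : ℕ) ≠ 0 ∧ Q w₀ = 0 ∧ aeval Q (resZero d v w₀) = 0).card * p ^ 2 ≤
      (resZero d v w₀).totalDegree * p ^ (2 * d + 2) := by
    by_cases hv0 : (v : ℕ) = 0
    · simp [hv0]
    · simpa only [ne_eq, hv0, not_false_eq_true, true_and] using
        card_hyperplane_le d (p := p) v w₀
          ⟨pairPt d 1 (Polynomial.X ^ d), by simp [pairPt, hv, Polynomial.coeff_one, hv0],
            by
              have : d ≠ 0 := by omega
              simp [pairPt, hw₀, Polynomial.coeff_X_pow, this.symm],
            by rw [resEval_pairPt, Polynomial.resultant_one_right]; simp⟩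
  have h3 : (Finset.univ.filter fun Q : Fin (2 * d + 2) → ZMod p =>
      (v : ℕ) ≠ d ∧ Q w₁ = 0 ∧ aeval Q (resZero d v w₁) = 0).card * p ^ 2 ≤
      (resZero d v w₁).totalDegree * p ^ (2 * d + 2) := by
    by_cases hvd : (v : ℕ) = d
    · simp [hvd]
    · simpa only [ne_eq, hvd, not_false_eq_true, true_and] using
        card_hyperplane_le d (p := p) v w₁
          ⟨pairPt d (Polynomial.X ^ d) 1, by simp [pairPt, hv, Polynomial.coeff_X_pow, hvd],
            by
              have h4 : ¬ (2 * d + 1 ≤ d) := by omega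
              have h5 : 2 * d + 1 - (d + 1) ≠ 0 := by omega
              simp only [pairPt, hw₁, h4, if_false, Polynomial.coeff_one, h5],
            by rw [resEval_pairPt, Polynomial.resultant_one_left]; simp⟩
  have hsub : (Finset.univ.filter fun Q : Fin (2 * d + 2) → ZMod p =>
        (slice d Q v).eval (Q v) = 0 ∧ (slice d Q v).derivative.eval (Q v) = 0) ⊆
      ((Finset.univ.filter fun Q : Fin (2 * d + 2) → ZMod p =>
        slice d Q v ≠ 0 ∧ (slice d Q v).eval (Q v) = 0 ∧
          (slice d Q v).derivative.eval (Q v) = 0) ∪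
      (Finset.univ.filter fun Q : Fin (2 * d + 2) → ZMod p =>
        (v : ℕ) ≠ 0 ∧ Q w₀ = 0 ∧ aeval Q (resZero d v w₀) = 0)) ∪
      (Finset.univ.filter fun Q : Fin (2 * d + 2) → ZMod p =>
        (v : ℕ) ≠ d ∧ Q w₁ = 0 ∧ aeval Q (resZero d v w₁) = 0) := by
    intro Q hQ
    simp only [Finset.mem_union, Finset.mem_filter, Finset.mem_univ, true_and] at hQ ⊢
    by_cases h0 : slice d Q v = 0
    · rcases eq_zero_or_eq_zero_of_slice_eq_zero d Q v hv h0 with ⟨h, h'⟩ | ⟨h, h'⟩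
      · exact Or.inl (Or.inr ⟨h', h, aeval_resZero_eq_zero d Q v w₀ h0 h⟩)
      · exact Or.inr ⟨h', h, aeval_resZero_eq_zero d Q v w₁ h0 h⟩
    · exact Or.inl (Or.inl ⟨h0, hQ⟩)
  have hcard := (Finset.card_le_card hsub).trans ((Finset.card_union_le _ _).trans
    (Nat.add_le_add_right (Finset.card_union_le _ _) _))
  refine (Nat.mul_le_mul_right (p ^ 2) hcard).trans ?_
  rw [add_mul, add_mul, add_mul, add_mul, add_mul]
  exact (Nat.add_le_add (Nat.add_le_add h1 h2) h3).trans (Nat.le_add_right _ _)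

open Classical in
lemma exists_card_mul_sq_le (d : ℕ) (hd : 2 ≤ d) (v : Fin (2 * d + 2)) :
    ∃ c : ℕ, ∀ p : ℕ, [Fact p.Prime] →
      (Finset.univ.filter fun Q : Fin (2 * d + 2) → ZMod p =>
        (slice d Q v).eval (Q v) = 0 ∧ (slice d Q v).derivative.eval (Q v) = 0).card * p ^ 2 ≤
      c * p ^ (2 * d + 2) := by
  by_cases hv : (v : ℕ) ≤ d
  · exact exists_card_mul_sq_le_of_le d hd v hv
  obtain ⟨u, rfl⟩ := (swapForms d).surjective v
  have hu : (u : ℕ) ≤ d := by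
    by_contra h
    simp [swapForms, h] at hv
    omega
  obtain ⟨c, hc⟩ := exists_card_mul_sq_le_of_le d hd u hu
  refine ⟨c, fun p _ => le_trans (Nat.mul_le_mul_right _ ?_) (hc p)⟩
  refine Finset.card_le_card_of_injOn (fun Q => Q ∘ swapForms d) ?_
    ((swapForms d).surjective.injective_comp_right.injOn)
  intro Q hQ
  have hs : ((-1) ^ (d * d) : Polynomial (ZMod p)) = Polynomial.C ((-1) ^ (d * d)) := by simp
  simp only [Finset.coe_filter, Finset.mem_univ, true_and, Set.mem_ofPred_eq] at hQ ⊢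
  rw [slice_comp_swapForms, hs, Polynomial.derivative_C_mul, Polynomial.eval_C_mul,
    Polynomial.eval_C_mul, Function.comp_apply, hQ.1, hQ.2]
  simp

/-- the common zero locus of `𝔯` and any one of its partial derivatives
over `𝔽_p` has at most `C·p^{2d}` points, with `C` depending only on `d`. -/
theorem stmt_7 (d : ℕ) (hd : 2 ≤ d) :
    ∃ C : ℝ, 0 < C ∧ ∀ p : ℕ, p.Prime → ∀ v : Fin (2 * d + 2),
      (Nat.card {Q : Fin (2 * d + 2) → ZMod p //
          resEval d Q = 0 ∧ aeval Q (pderiv v (resPoly d)) = 0} : ℝ) ≤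
        C * (p : ℝ) ^ (2 * d) := by
  classical
  choose c hc using exists_card_mul_sq_le d hd
  refine ⟨(∑ v, c v : ℕ) + 1, by positivity, fun p hp v => ?_⟩
  have : Fact p.Prime := ⟨hp⟩
  have hset : Nat.card {Q : Fin (2 * d + 2) → ZMod p //
      resEval d Q = 0 ∧ aeval Q (pderiv v (resPoly d)) = 0} =
      (Finset.univ.filter fun Q : Fin (2 * d + 2) → ZMod p =>
        (slice d Q v).eval (Q v) = 0 ∧ (slice d Q v).derivative.eval (Q v) = 0).card := by
    rw [Nat.card_eq_fintype_card, Fintype.card_subtype]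
    simp only [eval_slice, Function.update_eq_self, eval_derivative_slice]
  have h := hc v p
  rw [← hset, pow_add, ← mul_assoc] at h
  have h' := Nat.le_of_mul_le_mul_right h (pow_pos hp.pos 2)
  have hcv : c v ≤ (∑ v, c v) + 1 :=
    (Finset.single_le_sum (fun _ _ => Nat.zero_le _) (Finset.mem_univ v)).trans (Nat.le_succ _)
  exact_mod_cast h'.trans (Nat.mul_le_mul_right _ hcv)
end
end

section
/- Let p be a prime, n ≥ 1 an integer, and h ∈ ℤ_p[x_1,…,x_n] a polynomial over the ring of p-adic integers. Let α ∈ (ℤ/pℤ)^n be such that h(α) ≡ 0 (mod p) and (∂h/∂x_i)(α) ≢ 0 (mod p) for some i ∈ {1,…,n}. Then for every integer k ≥ 1, the number of points β ∈ (ℤ/p^kℤ)^n whose coordinatewise reduction mod p equals α and which satisfy h(β) = 0 in ℤ/p^kℤ is exactly p^{(n−1)(k−1)}. -/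
open Filter MvPolynomial

noncomputable section

/-- Partial first-order Taylor expansion of a multivariate polynomial. -/
theorem MvPolynomial.exists_eval_update_add {σ R : Type*} [CommRing R] [DecidableEq σ]
    (i : σ) (x : σ → R) (t : R) (H : MvPolynomial σ R) :
    ∃ c, eval (Function.update x i (x i + t)) H =
      eval x H + t * eval x (pderiv i H) + t ^ 2 * c := by
  induction H using MvPolynomial.induction_on with
  | C a => exact ⟨0, by simp⟩
  | add f g hf hg =>
    obtain ⟨c, hc⟩ := hf
    obtain ⟨d, hd⟩ := hg
    exact ⟨c + d, by simp only [map_add, hc, hd]; ring⟩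
  | mul_X f j hf =>
    obtain ⟨c, hc⟩ := hf
    by_cases hj : j = i
    · subst hj
      refine ⟨eval x (pderiv j f) + x j * c + t * c, ?_⟩
      simp only [map_mul, map_add, eval_X, hc, Function.update_self, Derivation.leibniz,
        pderiv_X_self, smul_eq_mul, mul_one]
      ring
    · refine ⟨x j * c, ?_⟩
      simp only [map_mul, eval_X, hc, Function.update_of_ne hj, Derivation.leibniz,
        pderiv_X_of_ne hj, smul_eq_mul, mul_zero, zero_add]
      ring

/-- All fibers of a surjective ring homomorphism have the cardinality of the kernel. -/
theorem RingHom.card_fiber_eq_card_ker {R F : Type*} [Ring R] [Ring F] (π : R →+* F)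
    (hπ : Function.Surjective π) (a : F) :
    Nat.card {r // π r = a} = Nat.card (RingHom.ker π) := by
  obtain ⟨s, rfl⟩ := hπ a
  exact Nat.card_congr ((Equiv.subRight s).subtypeEquiv fun r => by
    simp [RingHom.mem_ker, sub_eq_zero])

theorem Function.update_congr_of_eq_off {σ R : Type*} [DecidableEq σ] {i : σ} {x y : σ → R}
    (hxy : ∀ j, j ≠ i → x j = y j) : Function.update x i (y i) = y := by
  ext j
  by_cases hj : j = i
  · subst hj; simp
  · simp [hj, hxy j hj]

section Lifting

variable {σ R F : Type*} [CommRing R] [Field F] (π : R →+* F) [IsLocalHom π]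
  (H : MvPolynomial σ R) {α : σ → F} {i : σ}

/-- Lifts of a smooth point that agree away from the `i`-th coordinate and have the same value
under `H` are equal. -/
theorem MvPolynomial.eq_of_eval_eq_of_pderiv_ne_zero
    (hα' : eval α (map π (pderiv i H)) ≠ 0) {x y : σ → R} (hx : ∀ j, π (x j) = α j)
    (hy : ∀ j, π (y j) = α j) (hxy : ∀ j, j ≠ i → x j = y j) (he : eval x H = eval y H) :
    x = y := by
  classical
  obtain ⟨c, hc⟩ := exists_eval_update_add i x (y i - x i) H
  rw [add_sub_cancel, Function.update_congr_of_eq_off hxy, ← he] at hc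
  have hu : IsUnit (eval x (pderiv i H) + (y i - x i) * c) := by
    apply isUnit_of_map_unit π
    have hxα : (π ∘ x : σ → F) = α := _root_.funext hx
    have h0 : π (y i - x i) = 0 := by rw [map_sub, hx, hy, sub_self]
    rw [map_add, map_mul, h0, zero_mul, add_zero, isUnit_iff_ne_zero]
    rwa [← hxα, ← map_eval] at hα'
  have h0 : (y i - x i) * (eval x (pderiv i H) + (y i - x i) * c) = 0 := by
    linear_combination -hc
  rw [hu.mul_left_eq_zero, sub_eq_zero] at h0
  ext j
  by_cases hj : j = i
  · rw [hj, h0]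
  · exact hxy j hj

/-- Existence part of Hensel's lemma in a finite ring: the coordinates away from `i` of a lift of
a smooth zero can be prescribed. -/
theorem MvPolynomial.exists_lift_eval_eq_zero [Finite R] (hπ : Function.Surjective π)
    (hα : eval α (map π H) = 0) (hα' : eval α (map π (pderiv i H)) ≠ 0) (x : σ → R)
    (hx : ∀ j, j ≠ i → π (x j) = α j) :
    ∃ y : σ → R, (∀ j, π (y j) = α j) ∧ eval y H = 0 ∧ ∀ j, j ≠ i → y j = x j := by
  classical
  have hlift (r : {r // π r = α i}) (j : σ) : π (Function.update x i r.1 j) = α j := by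
    by_cases hj : j = i
    · subst hj; simpa using r.2
    · simpa [hj] using hx j hj
  let Φ : {r // π r = α i} → {r // π r = 0} := fun r =>
    ⟨eval (Function.update x i r.1) H, by
      rw [map_eval, show (π ∘ Function.update x i r.1 : σ → F) = α from _root_.funext (hlift r), hα]⟩
  have hinj : Function.Injective Φ := by
    intro r s hrs
    have := eq_of_eval_eq_of_pderiv_ne_zero π H hα' (hlift r) (hlift s)
      (fun j hj => by simp [hj]) (congrArg Subtype.val hrs)
    exact Subtype.ext (by simpa using congrFun this i)
  have hbij := (Nat.bijective_iff_injective_and_card Φ).2 ⟨hinj, by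
    rw [π.card_fiber_eq_card_ker hπ, π.card_fiber_eq_card_ker hπ]⟩
  obtain ⟨r, hr⟩ := hbij.2 ⟨0, map_zero π⟩
  exact ⟨_, hlift r, congrArg Subtype.val hr, fun j hj => by simp [hj]⟩

/-- The number of lifts of a smooth zero along a surjective local homomorphism from a finite ring
to a field. -/
theorem MvPolynomial.card_lifts_eval_eq_zero [Fintype σ] [Finite R]
    (hπ : Function.Surjective π) (hα : eval α (map π H) = 0)
    (hα' : eval α (map π (pderiv i H)) ≠ 0) :
    Nat.card {β : σ → R // (∀ j, π (β j) = α j) ∧ eval β H = 0} =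
      Nat.card (RingHom.ker π) ^ (Fintype.card σ - 1) := by
  classical
  let Ψ : {β : σ → R // (∀ j, π (β j) = α j) ∧ eval β H = 0} →
      ((j : {j // j ≠ i}) → {r // π r = α j}) := fun β j => ⟨β.1 j, β.2.1 j⟩
  have hΨ : Function.Bijective Ψ := by
    constructor
    · intro β γ hβγ
      exact Subtype.ext (eq_of_eval_eq_of_pderiv_ne_zero π H hα' β.2.1 γ.2.1
        (fun j hj => congrArg Subtype.val (congrFun hβγ ⟨j, hj⟩)) (β.2.2.trans γ.2.2.symm))
    · intro f
      obtain ⟨y, hy, hy0, hyf⟩ := exists_lift_eval_eq_zero π H hπ hα hα'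
        (fun j => if hj : j ≠ i then (f ⟨j, hj⟩).1 else 0)
        (fun j hj => by simpa [hj] using (f ⟨j, hj⟩).2)
      refine ⟨⟨y, hy, hy0⟩, ?_⟩
      ext j
      simpa [Ψ, j.2] using hyf j j.2
  rw [Nat.card_eq_of_bijective Ψ hΨ, Nat.card_pi]
  simp [π.card_fiber_eq_card_ker hπ, Fintype.card_subtype_compl]

end Lifting

/-- `PadicInt.toZMod` is the only ring homomorphism `ℤ_p → ℤ/pℤ`. -/
theorem PadicInt.eq_toZMod {p : ℕ} [Fact p.Prime] (f : PadicInt p →+* ZMod p) :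
    f = PadicInt.toZMod := by
  ext x
  have hx := sub_zmodRepr_mem x
  rw [maximalIdeal_eq_span_p, Ideal.mem_span_singleton] at hx
  obtain ⟨y, hy⟩ := hx
  rw [sub_eq_iff_eq_add.1 hy]
  simp

theorem ZMod.isLocalHom_castHom_prime_pow {p k : ℕ} [Fact p.Prime] (hk : p ∣ p ^ k) :
    IsLocalHom (ZMod.castHom hk (ZMod p)) := by
  have hp : p.Prime := Fact.out
  have : NeZero (p ^ k) := ⟨pow_ne_zero _ hp.ne_zero⟩
  refine ⟨fun a ha => ?_⟩
  obtain ⟨m, rfl⟩ := ZMod.natCast_zmod_surjective a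
  rw [map_natCast, ZMod.isUnit_iff_coprime] at ha
  exact (ZMod.isUnit_iff_coprime _ _).2 (ha.pow_right k)

theorem ZMod.card_ker_castHom_prime_pow {p k : ℕ} [Fact p.Prime] (hk : 1 ≤ k)
    (hd : p ∣ p ^ k) : Nat.card (RingHom.ker (ZMod.castHom hd (ZMod p))) = p ^ (k - 1) := by
  have hp : p.Prime := Fact.out
  have h := AddSubgroup.card_mul_index (ZMod.castHom hd (ZMod p)).toAddMonoidHom.ker
  rw [AddSubgroup.index_ker, AddMonoidHom.range_eq_top.2 (ZMod.castHom_surjective hd),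
    AddSubgroup.card_top, Nat.card_zmod, Nat.card_zmod] at h
  apply Nat.eq_of_mul_eq_mul_right hp.pos
  rw [← pow_succ, Nat.sub_add_cancel hk]
  exact h

/-- Hensel-type counting of lifts. -/
theorem stmt_8 (p : ℕ) [Fact p.Prime] (n : ℕ) (hn : 1 ≤ n)
    (h : MvPolynomial (Fin n) (PadicInt p)) (α : Fin n → ZMod p)
    (hα : eval α (MvPolynomial.map PadicInt.toZMod h) = 0)
    (hα' : ∃ i, eval α (MvPolynomial.map PadicInt.toZMod (pderiv i h)) ≠ 0) :
    ∀ (k : ℕ) (hk : 1 ≤ k),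
      Nat.card {β : Fin n → ZMod (p ^ k) //
        (∀ i, ZMod.castHom (dvd_pow_self p (Nat.one_le_iff_ne_zero.mp hk)) (ZMod p) (β i)
            = α i) ∧
        eval β (MvPolynomial.map (PadicInt.toZModPow k) h) = 0} =
      p ^ ((n - 1) * (k - 1)) := by
  intro k hk
  obtain ⟨i, hi⟩ := hα'
  have hd : p ∣ p ^ k := dvd_pow_self p (Nat.one_le_iff_ne_zero.mp hk)
  have := ZMod.isLocalHom_castHom_prime_pow hd
  have : NeZero (p ^ k) := ⟨pow_ne_zero _ (Fact.out : p.Prime).ne_zero⟩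
  have hcomp := PadicInt.eq_toZMod ((ZMod.castHom hd (ZMod p)).comp (PadicInt.toZModPow k))
  rw [MvPolynomial.card_lifts_eval_eq_zero (i := i) (ZMod.castHom hd (ZMod p)) _
      (ZMod.castHom_surjective hd) (by rwa [MvPolynomial.map_map, hcomp])
      (by rwa [pderiv_map, MvPolynomial.map_map, hcomp]),
    ZMod.card_ker_castHom_prime_pow hk hd, Fintype.card_fin, ← pow_mul, mul_comm]
end
end
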